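/- arXiv:2010.08671 — 12 statements merged into one kernel-verified Lean document; each statement's English description precedes it below -/
import Mathlib

section
/- Let Γ be a subgroup of (ℂ, +) containing 1. The automorphism group of the Γ-Witt algebra W_Γ is exactly {φ_{a,f} | f ∈ Γ^∨, a ∈ ℂ* with aΓ = Γ}, where φ_{a,f} is the Lie algebra automorphism determined by φ_{a,f}(L_m) = a f(m) L_{m/a}. That is: every such φ_{a,f} is a Lie algebra automorphism of W_Γ, and every Lie algebra automorphism of W_Γ is of this form. -/
open Finsupp

/-- The `Γ`-Witt algebra bracket on `↥Γ →₀ ℂ` (basis `L_m`, `m ∈ Γ`; `L_m` is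
`Finsupp.single m 1`), determined by `[L_m, L_n] = (m - n) L_{m+n}`. -/
noncomputable def wittBracket (Γ : AddSubgroup ℂ) (x y : ↥Γ →₀ ℂ) : ↥Γ →₀ ℂ :=
  x.sum fun m a => y.sum fun n b =>
    (a * b * ((m : ℂ) - (n : ℂ))) • Finsupp.single (m + n) (1 : ℂ)

theorem wb_add_left (Γ : AddSubgroup ℂ) (x x' y : ↥Γ →₀ ℂ) :
    wittBracket Γ (x + x') y = wittBracket Γ x y + wittBracket Γ x' y := by
  unfold wittBracket
  rw [Finsupp.sum_add_index']
  · intro m; simp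
  · intro m b c
    rw [← Finsupp.sum_add]
    congr 1; ext1 n; ext1 d
    rw [← add_smul]; congr 1; ring

theorem wb_add_right (Γ : AddSubgroup ℂ) (x y y' : ↥Γ →₀ ℂ) :
    wittBracket Γ x (y + y') = wittBracket Γ x y + wittBracket Γ x y' := by
  unfold wittBracket
  rw [← Finsupp.sum_add]
  congr 1; ext1 m; ext1 d
  rw [Finsupp.sum_add_index']
  · intro m; simp
  · intro m b c
    rw [← add_smul]; congr 1; ring

theorem wb_zero_left (Γ : AddSubgroup ℂ) (y : ↥Γ →₀ ℂ) : wittBracket Γ 0 y = 0 := by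
  simp [wittBracket]

theorem wb_zero_right (Γ : AddSubgroup ℂ) (y : ↥Γ →₀ ℂ) : wittBracket Γ y 0 = 0 := by
  simp [wittBracket]

theorem wb_single (Γ : AddSubgroup ℂ) (m n : ↥Γ) (b c : ℂ) :
    wittBracket Γ (Finsupp.single m b) (Finsupp.single n c) =
      Finsupp.single (m + n) (b * c * ((m : ℂ) - n)) := by
  simp [wittBracket]

theorem wb_zero_apply (Γ : AddSubgroup ℂ) (c : ℂ) (y : ↥Γ →₀ ℂ) (q : ↥Γ) :
    wittBracket Γ (Finsupp.single 0 c) y q = - (c * q * y q) := by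
  induction y using Finsupp.induction_linear with
  | zero => simp [wb_zero_right]
  | add y z hy hz => rw [wb_add_right, Finsupp.add_apply, hy, hz, Finsupp.add_apply]; ring
  | single n d =>
    rw [wb_single, zero_add]
    by_cases h : n = q
    · subst h; simp; ring
    · simp [Finsupp.single_eq_of_ne' h]

theorem wb_top {A : Type*} [AddCommGroup A] [LinearOrder A] [IsOrderedAddMonoid A]
    (Γ : AddSubgroup ℂ) (e : ↥Γ →+ A) (he : Function.Injective e)
    (x y : ↥Γ →₀ ℂ) (m q : ↥Γ) (hx : ∀ i ∈ x.support, e i ≤ e m)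
    (hy : ∀ i ∈ y.support, e i ≤ e q) :
    wittBracket Γ x y (m + q) = x m * y q * ((m : ℂ) - q) := by
  have key : ∀ i ∈ x.support, ∀ j ∈ y.support, i + j = m + q → i = m ∧ j = q := by
    intro i hi j hj hij
    have h1 := hx i hi
    have h2 := hy j hj
    have h3 : e i + e j = e m + e q := by rw [← map_add, hij, map_add]
    have h4 : e i = e m := by
      by_contra hne
      have := add_lt_add_of_lt_of_le (lt_of_le_of_ne h1 hne) h2
      exact absurd h3 this.ne
    have h5 := he h4
    subst h5
    exact ⟨rfl, add_left_cancel hij⟩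
  unfold wittBracket
  simp only [Finsupp.sum, Finsupp.finsetSum_apply, Finsupp.smul_apply, smul_eq_mul]
  rw [Finset.sum_eq_single m, Finset.sum_eq_single q]
  · simp
  · intro j hj hjq
    rw [Finsupp.single_eq_of_ne' (fun h => hjq (add_left_cancel h)), mul_zero]
  · intro h; simp [Finsupp.notMem_support_iff.1 h]
  · intro i hi him
    apply Finset.sum_eq_zero
    intro j hj
    rw [Finsupp.single_eq_of_ne' (fun h => him (key i hi j hj h).1), mul_zero]
  · intro h; simp [Finsupp.notMem_support_iff.1 h]

theorem aut_zero_le {A : Type*} [AddCommGroup A] [LinearOrder A] [IsOrderedAddMonoid A]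
    (Γ : AddSubgroup ℂ) (e : ↥Γ →+ A) (he : Function.Injective e)
    (φ : (↥Γ →₀ ℂ) ≃ₗ[ℂ] (↥Γ →₀ ℂ))
    (hφ : ∀ x y, φ (wittBracket Γ x y) = wittBracket Γ (φ x) (φ y)) :
    ∀ i ∈ (φ (Finsupp.single 0 1)).support, e i ≤ 0 := by
  by_contra hcon
  push Not at hcon
  obtain ⟨i, hi, hi0⟩ := hcon
  set x := φ (Finsupp.single 0 1) with hxdef
  obtain ⟨m, hm, hmax⟩ := Finset.exists_max_image x.support e ⟨i, hi⟩
  have hm0 : 0 < e m := lt_of_lt_of_le hi0 (hmax i hi)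
  have hS : ∀ z, φ z ∈ Finsupp.supported ℂ ℂ {q : ↥Γ | e q ≤ e m} := by
    intro z
    induction z using Finsupp.induction_linear with
    | zero => simp
    | add y z hy hz => rw [map_add]; exact Submodule.add_mem _ hy hz
    | single n d =>
      have h1 : Finsupp.single n d = d • Finsupp.single n (1 : ℂ) := by simp
      rw [h1, map_smul]
      apply Submodule.smul_mem
      set y := φ (Finsupp.single n 1) with hy
      have hy0 : y ≠ 0 := by
        rw [hy]; simp
      obtain ⟨q, hq, hqmax⟩ := Finset.exists_max_image y.support e
        (Finsupp.support_nonempty_iff.2 hy0)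
      have h2 := wb_top Γ e he x y m q hmax hqmax
      have h3 : wittBracket Γ x y = (-(n : ℂ)) • y := by
        rw [hxdef, hy, ← hφ, wb_single, ← map_smul]
        simp
      have h4 : y (m + q) = 0 := by
        by_contra hne
        have := hqmax (m + q) (Finsupp.mem_support_iff.2 hne)
        rw [map_add] at this
        exact absurd (lt_add_of_pos_left (e q) hm0) (not_lt.2 this)
      rw [h3, Finsupp.smul_apply, h4, smul_zero] at h2
      have hxm := Finsupp.mem_support_iff.1 hm
      have hyq := Finsupp.mem_support_iff.1 hq
      have h5 : m = q := by
        apply Subtype.ext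
        have := (mul_eq_zero.1 h2.symm).resolve_left (mul_ne_zero hxm hyq)
        exact sub_eq_zero.1 this
      rw [Finsupp.mem_supported]
      intro j hj
      have := hqmax j hj
      rw [← h5] at this
      exact this
  have h6 := hS (φ.symm (Finsupp.single (m + m) 1))
  rw [LinearEquiv.apply_symm_apply, Finsupp.mem_supported] at h6
  have h7 : (m + m) ∈ ((Finsupp.single (m + m) (1 : ℂ)).support : Set ↥Γ) := by simp
  have h8 : e (m + m) ≤ e m := h6 h7
  rw [map_add] at h8
  exact absurd (lt_add_of_pos_left (e m) hm0) (not_lt.2 h8)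

noncomputable def lexHom (Γ : AddSubgroup ℂ) : ↥Γ →+ (ℝ ×ₗ ℝ) where
  toFun z := toLex ((z : ℂ).re, (z : ℂ).im)
  map_zero' := by simp
  map_add' x y := by simp; rfl

theorem lexHom_inj (Γ : AddSubgroup ℂ) : Function.Injective (lexHom Γ) := by
  intro x y h
  have h' : ((x : ℂ).re, (x : ℂ).im) = ((y : ℂ).re, (y : ℂ).im) := toLex.injective h
  rw [Prod.mk.injEq] at h'
  exact Subtype.ext (Complex.ext h'.1 h'.2)

theorem aut_zero (Γ : AddSubgroup ℂ) (φ : (↥Γ →₀ ℂ) ≃ₗ[ℂ] (↥Γ →₀ ℂ))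
    (hφ : ∀ x y, φ (wittBracket Γ x y) = wittBracket Γ (φ x) (φ y)) :
    ∃ c : ℂ, c ≠ 0 ∧ φ (Finsupp.single 0 1) = Finsupp.single 0 c := by
  have h1 := aut_zero_le Γ (lexHom Γ) (lexHom_inj Γ) φ hφ
  have h2 := aut_zero_le Γ (-lexHom Γ)
    (fun x y h => lexHom_inj Γ (neg_injective h)) φ hφ
  have h3 : φ (Finsupp.single 0 1) = Finsupp.single 0 (φ (Finsupp.single 0 1) 0) := by
    ext q
    by_cases hq : q = 0
    · subst hq; simp
    · rw [Finsupp.single_eq_of_ne hq]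
      by_contra hne
      have hs := Finsupp.mem_support_iff.2 hne
      have e1 := h1 q hs
      have e2 := h2 q hs
      rw [AddMonoidHom.neg_apply, neg_nonpos] at e2
      apply hq
      apply lexHom_inj Γ
      rw [map_zero]
      exact le_antisymm e1 e2
  refine ⟨_, ?_, h3⟩
  intro h0
  rw [h0] at h3
  simp at h3

theorem aut_single (Γ : AddSubgroup ℂ) (φ : (↥Γ →₀ ℂ) ≃ₗ[ℂ] (↥Γ →₀ ℂ))
    (hφ : ∀ x y, φ (wittBracket Γ x y) = wittBracket Γ (φ x) (φ y)) (c : ℂ) (hc : c ≠ 0)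
    (h0 : φ (Finsupp.single 0 1) = Finsupp.single 0 c) (n : ↥Γ) :
    ∃ (q : ↥Γ) (d : ℂ), c * q = n ∧ d ≠ 0 ∧ φ (Finsupp.single n 1) = Finsupp.single q d := by
  set y := φ (Finsupp.single n 1) with hy
  have hy0 : y ≠ 0 := by rw [hy]; simp
  have h3 : wittBracket Γ (Finsupp.single 0 c) y = (-(n : ℂ)) • y := by
    rw [← h0, hy, ← hφ, wb_single, ← map_smul]
    simp
  have h4 : ∀ q, y q ≠ 0 → c * q = n := by
    intro q hq
    have := DFunLike.congr_fun h3 q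
    rw [wb_zero_apply, Finsupp.smul_apply, smul_eq_mul] at this
    apply mul_right_cancel₀ hq
    linear_combination -this
  obtain ⟨q, hq⟩ := Finsupp.support_nonempty_iff.2 hy0
  have hq := Finsupp.mem_support_iff.1 hq
  refine ⟨q, y q, h4 q hq, hq, ?_⟩
  ext p
  by_cases hp : p = q
  · subst hp; simp
  · rw [Finsupp.single_eq_of_ne hp]
    by_contra hne
    exact hp (Subtype.ext (mul_left_cancel₀ hc ((h4 p hne).trans (h4 q hq).symm)))

theorem part_one (Γ : AddSubgroup ℂ) (a : ℂ) (ha0 : a ≠ 0) (e : ↥Γ ≃ ↥Γ)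
    (he : ∀ m : ↥Γ, ((e m : ↥Γ) : ℂ) = (m : ℂ) / a) (f : ↥Γ → ℂ)
    (hf0 : ∀ m, f m ≠ 0) (hf : ∀ m n, f (m + n) = f m * f n) :
    ∃ φ : (↥Γ →₀ ℂ) ≃ₗ[ℂ] (↥Γ →₀ ℂ),
        (∀ x y, φ (wittBracket Γ x y) = wittBracket Γ (φ x) (φ y)) ∧
        ∀ m : ↥Γ, φ (Finsupp.single m 1) = (a * f m) • Finsupp.single (e m) 1 := by
  let F : (↥Γ →₀ ℂ) →ₗ[ℂ] (↥Γ →₀ ℂ) :=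
    Finsupp.linearCombination ℂ (fun m => (a * f m) • Finsupp.single (e m) (1 : ℂ))
  let G : (↥Γ →₀ ℂ) →ₗ[ℂ] (↥Γ →₀ ℂ) :=
    Finsupp.linearCombination ℂ
      (fun q => (a * f (e.symm q))⁻¹ • Finsupp.single (e.symm q) (1 : ℂ))
  have hF : ∀ m b, F (Finsupp.single m b) = Finsupp.single (e m) (b * (a * f m)) := by
    intro m b
    simp only [F, Finsupp.linearCombination_single, Finsupp.smul_single, smul_eq_mul, mul_one]
  have hG : ∀ m b, G (Finsupp.single m b) =
      Finsupp.single (e.symm m) (b * (a * f (e.symm m))⁻¹) := by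
    intro m b
    simp only [G, Finsupp.linearCombination_single, Finsupp.smul_single, smul_eq_mul, mul_one]
  have hne : ∀ m, a * f m ≠ 0 := fun m => mul_ne_zero ha0 (hf0 m)
  have hFG : F ∘ₗ G = LinearMap.id := by
    apply Finsupp.lhom_ext
    intro m b
    rw [LinearMap.comp_apply, hG, hF, e.apply_symm_apply, mul_assoc, inv_mul_cancel₀ (hne _)]
    simp
  have hGF : G ∘ₗ F = LinearMap.id := by
    apply Finsupp.lhom_ext
    intro m b
    rw [LinearMap.comp_apply, hF, hG, e.symm_apply_apply, mul_assoc, mul_inv_cancel₀ (hne _)]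
    simp
  have hadd : ∀ m n, e (m + n) = e m + e n := by
    intro m n
    apply Subtype.ext
    rw [AddSubgroup.coe_add, he, he, he, AddSubgroup.coe_add]; ring
  refine ⟨LinearEquiv.ofLinear F G hFG hGF, ?_, ?_⟩
  · intro x y
    simp only [LinearEquiv.ofLinear_apply]
    induction x using Finsupp.induction_linear with
    | zero => simp [wb_zero_left]
    | add x z hx hz => rw [wb_add_left, map_add, map_add, wb_add_left, hx, hz]
    | single m b =>
      induction y using Finsupp.induction_linear with
      | zero => simp [wb_zero_right]
      | add x z hx hz => rw [wb_add_right, map_add, map_add, wb_add_right, hx, hz]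
      | single n d =>
        rw [wb_single, hF, hF, hF, wb_single, hadd, hf, he, he]
        congr 1
        field_simp
  · intro m
    rw [LinearEquiv.ofLinear_apply, hF]
    simp

theorem part_two (Γ : AddSubgroup ℂ) (φ : (↥Γ →₀ ℂ) ≃ₗ[ℂ] (↥Γ →₀ ℂ))
    (hφ : ∀ x y, φ (wittBracket Γ x y) = wittBracket Γ (φ x) (φ y)) :
    ∃ (a : ℂ), a ≠ 0 ∧ (∀ x : ℂ, x ∈ Γ ↔ a * x ∈ Γ) ∧ ∃ (f : ↥Γ → ℂ),
        (∀ m, f m ≠ 0) ∧ (∀ m n, f (m + n) = f m * f n) ∧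
        ∀ m q : ↥Γ, a * q = m → φ (Finsupp.single m 1) = (a * f m) • Finsupp.single q 1 := by
  obtain ⟨c, hc, h0⟩ := aut_zero Γ φ hφ
  choose g d hg hd hgd using aut_single Γ φ hφ c hc h0
  have hψ : ∀ x y, φ.symm (wittBracket Γ x y) = wittBracket Γ (φ.symm x) (φ.symm y) := by
    intro x y
    apply φ.injective
    rw [hφ]; simp
  have hψ0 : φ.symm (Finsupp.single 0 1) = Finsupp.single 0 c⁻¹ := by
    apply φ.injective
    have : Finsupp.single (0 : ↥Γ) c⁻¹ = c⁻¹ • Finsupp.single (0 : ↥Γ) (1 : ℂ) := by simp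
    rw [this, map_smul, h0]
    simp [hc]
  have hinv := aut_single Γ φ.symm hψ c⁻¹ (inv_ne_zero hc) hψ0
  have hgadd : ∀ m n, g (m + n) = g m + g n := by
    intro m n
    apply Subtype.ext
    apply mul_left_cancel₀ hc
    rw [hg, AddSubgroup.coe_add, AddSubgroup.coe_add, mul_add, hg, hg]
  have hmul : ∀ m n : ↥Γ, m ≠ n → d (m + n) / c = d m / c * (d n / c) := by
    intro m n hmn
    have h := hφ (Finsupp.single m 1) (Finsupp.single n 1)
    have h5 : Finsupp.single (m + n) (1 * 1 * ((m : ℂ) - n)) =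
        ((m : ℂ) - n) • Finsupp.single (m + n) (1 : ℂ) := by simp
    rw [hgd, hgd, wb_single, wb_single, h5, map_smul, hgd, hgadd, Finsupp.smul_single,
      smul_eq_mul] at h
    have h6 := Finsupp.single_injective _ h
    have hne : (m : ℂ) - n ≠ 0 := sub_ne_zero.2 (fun h => hmn (Subtype.ext h))
    have h7 : (g m : ℂ) - g n = ((m : ℂ) - n) / c := by
      rw [← hg m, ← hg n]; field_simp
    rw [h7] at h6
    apply mul_left_cancel₀ hne
    have h8 : ((m : ℂ) - n) * (d (m + n) / c) = (((m : ℂ) - n) * d (m + n)) / c := by ring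
    rw [h8, h6]
    ring
  have hd0 : d 0 / c = 1 := by
    have h := hgd 0
    have hg0 : g 0 = 0 := by
      apply Subtype.ext
      apply mul_left_cancel₀ hc
      rw [hg]; simp
    rw [h0, hg0] at h
    rw [← Finsupp.single_injective _ h, div_self hc]
  set f : ↥Γ → ℂ := fun m => d m / c with hfdef
  have hfne : ∀ m, f m ≠ 0 := fun m => div_ne_zero (hd m) hc
  have hfm : ∀ m n, m ≠ n → f (m + n) = f m * f n := hmul
  have hf0 : f 0 = 1 := hd0
  refine ⟨c, hc, ?_, f, hfne, ?_, ?_⟩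
  · intro x
    constructor
    · intro hx
      obtain ⟨q, -, hq, -⟩ := hinv ⟨x, hx⟩
      have : (q : ℂ) = c * x := by
        have hq' : c⁻¹ * (q : ℂ) = x := hq
        rw [← hq']; field_simp
      rw [← this]; exact q.2
    · intro hx
      have h := hg ⟨c * x, hx⟩
      rw [← mul_left_cancel₀ hc h]
      exact (g _).2
  · intro m n
    by_cases hmn : m = n
    · subst hmn
      by_cases hm : m = 0
      · subst hm; simp [hf0]
      · have hmC : (m : ℂ) ≠ 0 := fun h => hm (Subtype.ext h)
        have ne : ∀ i j : ℤ, i ≠ j → i • m ≠ j • m := by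
          intro i j hij h
          have h' := congrArg (Subtype.val) h
          simp only [AddSubgroup.coe_zsmul, zsmul_eq_mul] at h'
          exact hij (by exact_mod_cast mul_right_cancel₀ hmC h')
        have F : ∀ i j : ℤ, i ≠ j → f ((i + j) • m) = f (i • m) * f (j • m) := by
          intro i j hij
          rw [add_smul]; exact hfm _ _ (ne i j hij)
        have e3 := F 2 1 (by norm_num)
        have e4 := F 3 1 (by norm_num)
        have e5 := F 3 2 (by norm_num)
        have e6 := F 5 (-1) (by norm_num)
        have e7 := F 1 (-1) (by norm_num)
        norm_num at e3 e4 e5 e6 e7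
        rw [hf0] at e7
        have h2 : f (m + m) = f ((2 : ℤ) • m) := by rw [two_zsmul]
        rw [h2]
        apply mul_left_cancel₀ (hfne ((2 : ℤ) • m))
        rw [e5, e3, e4, e3] at e6
        linear_combination -e6 + f ((2 : ℤ) • m) ^ 2 * e7
    · exact hfm m n hmn
  · intro m q hq
    have : q = g m := Subtype.ext (mul_left_cancel₀ hc (hq.trans (hg m).symm))
    rw [hgd, this, hfdef]
    simp [mul_div_cancel₀, hc]

/-- `Aut(W_Γ) = {φ_{a,f} | f ∈ Γ^∨, a ∈ ℂ*, aΓ = Γ}` where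
`φ_{a,f}(L_m) = a f(m) L_{m/a}`:
(1) every `φ_{a,f}` (with `f ∈ Γ^∨`, `a ≠ 0`, `aΓ = Γ`) extends to a Lie algebra
automorphism of `W_Γ`, and
(2) every Lie algebra automorphism of `W_Γ` (a linear self-equivalence preserving
the bracket) is of this form. -/
theorem stmt1 (Γ : AddSubgroup ℂ) (h1 : (1 : ℂ) ∈ Γ) :
    (∀ (a : ℂ) (ha0 : a ≠ 0) (ha : ∀ x : ℂ, x ∈ Γ ↔ a * x ∈ Γ) (f : ↥Γ → ℂ),
      (∀ m, f m ≠ 0) → (∀ m n, f (m + n) = f m * f n) →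
      ∃ φ : (↥Γ →₀ ℂ) ≃ₗ[ℂ] (↥Γ →₀ ℂ),
        (∀ x y, φ (wittBracket Γ x y) = wittBracket Γ (φ x) (φ y)) ∧
        ∀ m : ↥Γ, φ (Finsupp.single m 1) =
          (a * f m) • Finsupp.single
            (⟨(m : ℂ) / a, (ha ((m : ℂ) / a)).mpr (by
              rw [show a * ((m : ℂ) / a) = (m : ℂ) by field_simp]; exact m.2)⟩ : ↥Γ) 1) ∧
    (∀ φ : (↥Γ →₀ ℂ) ≃ₗ[ℂ] (↥Γ →₀ ℂ),
      (∀ x y, φ (wittBracket Γ x y) = wittBracket Γ (φ x) (φ y)) →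
      ∃ (a : ℂ) (ha0 : a ≠ 0) (ha : ∀ x : ℂ, x ∈ Γ ↔ a * x ∈ Γ) (f : ↥Γ → ℂ),
        (∀ m, f m ≠ 0) ∧ (∀ m n, f (m + n) = f m * f n) ∧
        ∀ m : ↥Γ, φ (Finsupp.single m 1) =
          (a * f m) • Finsupp.single
            (⟨(m : ℂ) / a, (ha ((m : ℂ) / a)).mpr (by
              rw [show a * ((m : ℂ) / a) = (m : ℂ) by field_simp]; exact m.2)⟩ : ↥Γ) 1) := by
  constructor
  · intro a ha0 ha f hf0 hf
    let e : ↥Γ ≃ ↥Γ :=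
      { toFun := fun m => ⟨(m : ℂ) / a, (ha ((m : ℂ) / a)).mpr (by
              rw [show a * ((m : ℂ) / a) = (m : ℂ) by field_simp]; exact m.2)⟩
        invFun := fun m => ⟨a * (m : ℂ), (ha m).mp m.2⟩
        left_inv := fun m => Subtype.ext (by simp only; field_simp)
        right_inv := fun m => Subtype.ext (by simp only; field_simp) }
    exact part_one Γ a ha0 e (fun m => rfl) f hf0 hf
  · intro φ hφ
    obtain ⟨a, ha0, ha, f, hf0, hf, h⟩ := part_two Γ φ hφ
    refine ⟨a, ha0, ha, f, hf0, hf, ?_⟩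
    intro m
    apply h
    simp only
    field_simp
end

section
/- Let Γ be a subgroup of (ℂ, +) containing 1, f, f' ∈ Γ^∨ and α, α' ∈ ℂ. If the W_Γ-modules Ω_Γ(f, α) and Ω_Γ(f', α') are isomorphic, then f = f' and α = α'. -/
open Polynomial

/-- The action of the basis element `L_m` (`m ∈ Γ`) of the `Γ`-Witt algebra on the
module `Ω_Γ(f, α) = ℂ[L₀]` (here `L₀ = X`):
`L_m ⬝ P(L₀) = f(m) (L₀ + m α) P(L₀ + m)`. -/
noncomputable def omegaAct (Γ : AddSubgroup ℂ) (f : ↥Γ → ℂ) (α : ℂ) (m : ↥Γ)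
    (P : Polynomial ℂ) : Polynomial ℂ :=
  C (f m) * (X + C ((m : ℂ) * α)) * P.comp (X + C (m : ℂ))

/-- If `Ω_Γ(f, α) ≅ Ω_Γ(f', α')` as `W_Γ`-modules, then `f = f'` and `α = α'`. -/
theorem stmt4 (Γ : AddSubgroup ℂ) (h1 : (1 : ℂ) ∈ Γ)
    (f f' : ↥Γ → ℂ) (hf0 : ∀ m, f m ≠ 0) (hfadd : ∀ m n, f (m + n) = f m * f n)
    (hf0' : ∀ m, f' m ≠ 0) (hfadd' : ∀ m n, f' (m + n) = f' m * f' n)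
    (α α' : ℂ)
    (hiso : ∃ e : Polynomial ℂ ≃ₗ[ℂ] Polynomial ℂ,
      ∀ m P, e (omegaAct Γ f α m P) = omegaAct Γ f' α' m (e P)) :
    f = f' ∧ α = α' := by
  obtain ⟨e, he⟩ := hiso
  have hz : f 0 = 1 := by
    have h := hfadd 0 0
    rw [add_zero] at h
    exact (mul_left_cancel₀ (hf0 0) (by rw [mul_one]; exact h)).symm
  have hz' : f' 0 = 1 := by
    have h := hfadd' 0 0
    rw [add_zero] at h
    exact (mul_left_cancel₀ (hf0' 0) (by rw [mul_one]; exact h)).symm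
  have hX : ∀ P, e (X * P) = X * e P := by
    intro P
    have h := he 0 P
    simpa [omegaAct, hz, hz'] using h
  have hXn : ∀ n : ℕ, e (X ^ n) = X ^ n * e 1 := by
    intro n
    induction n with
    | zero => simp
    | succ k ih => rw [pow_succ', hX, ih, mul_assoc]
  have hP : ∀ P, e P = P * e 1 := by
    intro P
    induction P using Polynomial.induction_on' with
    | add p q hp hq => rw [map_add, hp, hq, add_mul]
    | monomial n a =>
      rw [← C_mul_X_pow_eq_monomial, ← smul_eq_C_mul, map_smul, hXn, smul_mul_assoc]
  have hu : e 1 ≠ 0 := by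
    intro h
    have h2 := e.injective (h.trans (map_zero e).symm)
    exact one_ne_zero h2
  have hunit : IsUnit (e 1) := by
    obtain ⟨P, hPe⟩ := e.surjective 1
    rw [hP] at hPe
    exact IsUnit.of_mul_eq_one P (by rw [mul_comm]; exact hPe)
  obtain ⟨c, hc, hce⟩ := Polynomial.isUnit_iff.mp hunit
  have key : ∀ m : ↥Γ, C (f m) * (X + C ((m : ℂ) * α)) = C (f' m) * (X + C ((m : ℂ) * α')) := by
    intro m
    have h := he m 1
    rw [hP] at h
    simp only [omegaAct, one_comp, mul_one] at h
    have h3 : (e 1).comp (X + C (m : ℂ)) = e 1 := by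
      rw [← hce, C_comp]
    rw [h3] at h
    exact mul_right_cancel₀ hu h
  have hff : f = f' := by
    funext m
    have h := congrArg (fun p => coeff p 1) (key m)
    simpa [coeff_X, coeff_C] using h
  refine ⟨hff, ?_⟩
  have h := congrArg (fun p => coeff p 0) (key ⟨1, h1⟩)
  rw [← hff] at h
  have h5 := hf0 ⟨1, h1⟩
  simpa [coeff_C, h5] using h
end

section
/- Let Γ be a subgroup of ℂ × ℤ₂ with Γ_1 nonempty, f, f' ∈ Γ^∨ and α, α' ∈ ℂ. Then Π(sΩ_Γ(f, α)), the parity shift of sΩ_Γ(f, α), is not isomorphic to sΩ_Γ(f', α') as an sW_Γ-module. -/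
open Polynomial

/-- The action of the homogeneous basis element of the `Γ`-Witt superalgebra indexed by
`p ∈ Γ ⊆ ℂ × ℤ₂` (`L_m` for `p = (m, 0)`, `G_r` for `p = (r, 1)`) on the module
`sΩ_Γ(f, α) = ℂ[L₀] ⊕ ξℂ[L₀]`, a pair `(P, Q)` standing for `P(L₀) + ξ Q(L₀)`:
`L_m (P + ξQ) = f(m)(L₀+mα)P(L₀+m) + f(m)(L₀+m(α+1/2)) ξQ(L₀+m)`,
`G_r (P + ξQ) = f(r)(L₀+2rα)Q(L₀+r) + f(r) ξP(L₀+r)`. -/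
noncomputable def sOmegaAct (Γ : AddSubgroup (ℂ × ZMod 2)) (f : ↥Γ → ℂ) (α : ℂ) (p : ↥Γ)
    (v : Polynomial ℂ × Polynomial ℂ) : Polynomial ℂ × Polynomial ℂ :=
  if (p : ℂ × ZMod 2).2 = 0 then
    (C (f p) * (X + C ((p : ℂ × ZMod 2).1 * α)) * v.1.comp (X + C (p : ℂ × ZMod 2).1),
     C (f p) * (X + C ((p : ℂ × ZMod 2).1 * (α + 1 / 2))) * v.2.comp (X + C (p : ℂ × ZMod 2).1))
  else
    (C (f p) * (X + C (2 * (p : ℂ × ZMod 2).1 * α)) * v.2.comp (X + C (p : ℂ × ZMod 2).1),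
     C (f p) * v.1.comp (X + C (p : ℂ × ZMod 2).1))

/-- If `Γ₁ ≠ ∅`, the parity shift `Π(sΩ_Γ(f, α))` (same underlying space and action,
with the two homogeneous components exchanged: its even part is `ξℂ[L₀]`, its odd part
is `ℂ[L₀]`) is not isomorphic to `sΩ_Γ(f', α')` via any even isomorphism of
`sW_Γ`-modules. -/
theorem stmt6 (Γ : AddSubgroup (ℂ × ZMod 2))
    (hne : ∃ r : ℂ, ((r, (1 : ZMod 2)) : ℂ × ZMod 2) ∈ Γ)
    (f f' : ↥Γ → ℂ) (hf0 : ∀ p, f p ≠ 0) (hfadd : ∀ p q, f (p + q) = f p * f q)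
    (hf0' : ∀ p, f' p ≠ 0) (hfadd' : ∀ p q, f' (p + q) = f' p * f' q)
    (α α' : ℂ) :
    ¬ ∃ e : (Polynomial ℂ × Polynomial ℂ) ≃ₗ[ℂ] (Polynomial ℂ × Polynomial ℂ),
      (∀ Q : Polynomial ℂ, (e (0, Q)).2 = 0) ∧
      (∀ P : Polynomial ℂ, (e (P, 0)).1 = 0) ∧
      ∀ (p : ↥Γ) v, e (sOmegaAct Γ f α p v) = sOmegaAct Γ f' α' p (e v) := by
  rintro ⟨e, -, h2, h⟩
  obtain ⟨r, hr⟩ := hne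
  have h10 : (1 : ZMod 2) ≠ 0 := by decide
  -- `G_r` maps the even part of the target onto its odd part
  let p : ↥Γ := ⟨(r, 1), hr⟩
  let S : Polynomial ℂ := C (f' p)⁻¹ * (e (1, 0)).2.comp (X - C r)
  have hS : sOmegaAct Γ f' α' p (S, 0) = e (1, 0) := by
    have hc : C (f' p) * C (f' p)⁻¹ = (1 : Polynomial ℂ) := by
      rw [← C_mul, mul_inv_cancel₀ (hf0' p), C_1]
    apply Prod.ext
    · simp [sOmegaAct, p, h10, h2]
    · have hX : ((X : Polynomial ℂ) - C r).comp (X + C r) = X := by simp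
      have : (sOmegaAct Γ f' α' p (S, 0)).2 = C (f' p) * S.comp (X + C r) := by
        simp [sOmegaAct, p, h10]
      rw [this]
      simp only [S]
      rw [mul_comp, C_comp, comp_assoc, hX, comp_X, ← mul_assoc, hc, one_mul]
  -- but the constant `1` is not in the image of `G_r` in the source
  have h3 : sOmegaAct Γ f α p (e.symm (S, 0)) = (1, 0) := by
    apply e.injective
    rw [h, e.apply_symm_apply, hS]
  have h4 := congrArg (fun v => eval (-(2 * r * α)) v.1) h3
  simp [sOmegaAct, p, h10] at h4
end

section
/- Let Γ be a subgroup of (ℂ, +) containing 1 and let M be a module over the Γ-Virasoro algebra V_Γ whose restriction to ℂ[L_0] is a free module of rank 1. Then the central element C acts on M by zero, and M is isomorphic as a V_Γ-module to Ω_Γ(f, α) for some f ∈ Γ^∨ and α ∈ ℂ. -/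
open Polynomial

open scoped Classical

lemma periodic_const (p : ℂ[X]) (a : ℂ) (ha : a ≠ 0) (h : ∀ x, p.eval (x + a) = p.eval x) :
    p = C (p.eval 0) := by
  have hk : ∀ k : ℕ, p.eval ((k : ℂ) * a) = p.eval 0 := by
    intro k
    induction k with
    | zero => simp
    | succ k ih => rw [← ih, ← h ((k : ℂ) * a)]; congr 1; push_cast; ring
  apply Polynomial.eq_of_infinite_eval_eq
  apply Set.Infinite.mono (s := Set.range (fun k : ℕ => (k : ℂ) * a))
  · rintro _ ⟨k, rfl⟩
    simp [hk]
  · apply Set.infinite_range_of_injective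
    intro i j hij
    simpa [ha] using hij

lemma natDegree_shift (p : ℂ[X]) (a : ℂ) : (p.comp (X + C a)).natDegree = p.natDegree := by
  rw [natDegree_comp, natDegree_X_add_C, mul_one]

lemma shift_sub_lt (p q : ℂ[X]) (a : ℂ) (hq : q ≠ 0) (h : q = p.comp (X + C a) - p) :
    q.natDegree < p.natDegree := by
  have hp : p ≠ 0 := by
    rintro rfl
    simp at h
    exact hq h
  have h0 : p.comp (X + C a) ≠ 0 := by
    intro h0
    apply hp
    have := congrArg (fun r => r.comp (X - C a)) h0
    simpa [comp_assoc] using this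
  have hlt : (p.comp (X + C a) - p).degree < (p.comp (X + C a)).degree := by
    apply degree_sub_lt_left _ h0
    · rw [leadingCoeff_comp (by simp)]; simp
    · rw [degree_eq_natDegree h0, degree_eq_natDegree hp, natDegree_shift]
  rw [← h] at hlt
  have := natDegree_lt_natDegree hq hlt
  rwa [natDegree_shift] at this

lemma core_poly (Γ : AddSubgroup ℂ) (h1 : (1 : ℂ) ∈ Γ) (g : Γ → ℂ[X]) (c : ℂ[X])
    (g0 : g 0 = X)
    (hc : ∀ m : Γ, c.comp (X + C (m : ℂ)) * g m = g m * c)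
    (hrel : ∀ m n : Γ, (g n).comp (X + C (m : ℂ)) * g m - (g m).comp (X + C (n : ℂ)) * g n
      = C ((m : ℂ) - n) * g (m + n) +
        C (if (m : ℂ) + (n : ℂ) = 0 then ((m : ℂ) ^ 3 - (m : ℂ)) / 12 else 0) * c) :
    c = 0 ∧ ∃ f : Γ → ℂ, (∀ m, f m ≠ 0) ∧ (∀ m n, f (m + n) = f m * f n) ∧
      ∃ α : ℂ, ∀ m : Γ, g m = C (f m) * (X + C ((m : ℂ) * α)) := by
  -- evaluated relations
  have rel : ∀ (m n : Γ) (x : ℂ), (m : ℂ) + n ≠ 0 →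
      (g n).eval (x + m) * (g m).eval x - (g m).eval (x + n) * (g n).eval x
        = ((m : ℂ) - n) * (g (m + n)).eval x := by
    intro m n x h
    have := congrArg (eval x) (hrel m n)
    simpa [h] using this
  have rel0 : ∀ (m : Γ) (x : ℂ),
      (g (-m)).eval (x + m) * (g m).eval x - (g m).eval (x - m) * (g (-m)).eval x
        = 2 * m * x + ((m : ℂ) ^ 3 - (m : ℂ)) / 12 * c.eval x := by
    intro m x
    have := congrArg (eval x) (hrel m (-m))
    simp [g0] at this
    rw [← sub_eq_add_neg] at this
    rw [this]; ring
  set o : Γ := ⟨1, h1⟩ with ho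
  have ho1 : (o : ℂ) = 1 := rfl
  have g1 : g o ≠ 0 := by
    intro h
    have := rel0 o 1
    simp [h, ho1] at this
  -- c is constant
  obtain ⟨k, hk⟩ : ∃ k, c = C k := by
    refine ⟨_, periodic_const c 1 one_ne_zero ?_⟩
    have h := hc o
    rw [mul_comm] at h
    have h := mul_left_cancel₀ g1 h
    intro x
    have := congrArg (eval x) h
    simpa [ho1] using this
  subst hk
  have quad : ∀ m : Γ, (m : ℂ) ≠ 0 → ∃ b d : ℂ,
      (g m) * (g (-m)).comp (X + C (m : ℂ)) = C 1 * X ^ 2 + C b * X + C d := by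
    intro m hm
    set H := (g m) * (g (-m)).comp (X + C (m : ℂ)) with hH
    set K := ((m : ℂ) ^ 3 - (m : ℂ)) / 12 * k with hK
    set b := (K + m ^ 2) / (m : ℂ) with hb
    have := periodic_const (H - (X ^ 2 + C b * X)) m hm (by
      intro x
      have := rel0 m (x + m)
      simp only [eval_C] at this
      rw [← hK] at this
      have hbm : b * m = K + m ^ 2 := by rw [hb]; field_simp
      simp only [hH, eval_sub, eval_mul, eval_comp, eval_add, eval_X, eval_C, eval_pow]
      rw [add_sub_cancel_right] at this
      linear_combination this - hbm)
    refine ⟨b, eval 0 (H - (X ^ 2 + C b * X)), ?_⟩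
    · rw [sub_eq_iff_eq_add] at this
      rw [C_1, one_mul, add_comm]; exact this
  have degs : ∀ m : Γ, (m : ℂ) ≠ 0 → g m ≠ 0 ∧ (g m).natDegree + (g (-m)).natDegree = 2 := by
    intro m hm
    obtain ⟨b, d, h⟩ := quad m hm
    have hn : (C 1 * X ^ 2 + C b * X + C d).natDegree = 2 := natDegree_quadratic one_ne_zero
    rw [← h] at hn
    have hne : (g m) * (g (-m)).comp (X + C (m : ℂ)) ≠ 0 := by
      intro h0; rw [h0] at hn; simp at hn
    have hne' := mul_ne_zero_iff.1 hne
    rw [natDegree_mul hne'.1 hne'.2, natDegree_shift] at hn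
    exact ⟨hne'.1, hn⟩
  have nz : ∀ m : Γ, (m : ℂ) ≠ 0 → (g m).natDegree ≠ 0 := by
    intro m hm hd
    obtain ⟨a, ha⟩ : ∃ a, g m = C a := ⟨_, eq_C_of_natDegree_eq_zero hd⟩
    have step : ∀ n l : Γ, l = m + n → (m : ℂ) - n ≠ 0 → (m : ℂ) + n ≠ 0 →
        (g l).natDegree < (g n).natDegree := by
      rintro n l rfl h1 h2
      have h := hrel m n
      rw [if_neg h2, ha] at h
      simp only [C_comp, C_0, zero_mul, add_zero] at h
      have ha0 : a ≠ 0 := by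
        rintro rfl
        exact (degs m hm).1 (by simp [ha])
      have hg : g (m + n) ≠ 0 := (degs (m + n) (by simpa using h2)).1
      have e : (C (((m : ℂ) - n) / a) * g (m + n)) = (g n).comp (X + C (m : ℂ)) - g n := by
        have hh : (C a : ℂ[X]) ≠ 0 := by simpa using ha0
        apply mul_left_cancel₀ hh
        rw [← mul_assoc, ← C_mul, mul_div_cancel₀ _ ha0, ← h]
        ring
      have hC : ((m : ℂ) - n) / a ≠ 0 := div_ne_zero h1 ha0
      have := shift_sub_lt _ _ _ (mul_ne_zero (by simpa using hC) hg) e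
      rwa [natDegree_C_mul hC] at this
    have s1 := step (2 • m) (3 • m) (by abel) (by simp; intro h; apply hm; linear_combination -h)
      (by simp; intro h; apply hm; linear_combination h / 3)
    have s2 := step (3 • m) (4 • m) (by abel) (by simp; intro h; apply hm; linear_combination -h / 2)
      (by simp; intro h; apply hm; linear_combination h / 4)
    have s3 := step (4 • m) (5 • m) (by abel) (by simp; intro h; apply hm; linear_combination -h / 3)
      (by simp; intro h; apply hm; linear_combination h / 5)
    have := (degs (2 • m) (by simpa using hm)).2
    omega
  have lin : ∀ m : Γ, ∃ f β : ℂ, f ≠ 0 ∧ ((m : ℂ) = 0 → f = 1 ∧ β = 0) ∧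
      g m = C f * (X + C β) := by
    intro m
    by_cases hm : (m : ℂ) = 0
    · have : m = 0 := Subtype.ext hm
      subst this
      exact ⟨1, 0, one_ne_zero, by simp, by simp [g0]⟩
    · have h1 := nz m hm
      have h2 := nz (-m) (by simpa using hm)
      have h3 := (degs m hm).2
      have h4 : (g m).natDegree = 1 := by omega
      obtain ⟨a, ha, b, hb⟩ := natDegree_eq_one.1 h4
      refine ⟨a, b / a, ha, fun h => absurd h hm, ?_⟩
      rw [← hb, mul_add, ← C_mul, mul_div_cancel₀ _ ha]
  choose f β hf hf0 hg using lin
  have R : ∀ m n : Γ, (m : ℂ) + n ≠ 0 → (m : ℂ) ≠ n →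
      f (m + n) = f m * f n ∧ ((m : ℂ) - n) * β (m + n) = m * β m - n * β n := by
    intro m n h1 h2
    have e0 := rel m n 0 h1
    have e1 := rel m n 1 h1
    simp only [hg, eval_mul, eval_C, eval_add, eval_X] at e0 e1
    have hmn : (m : ℂ) - n ≠ 0 := sub_ne_zero.2 h2
    have ef : f (m + n) = f m * f n := by
      apply mul_left_cancel₀ hmn
      linear_combination e0 - e1
    refine ⟨ef, ?_⟩
    rw [ef] at e0
    apply mul_left_cancel₀ (mul_ne_zero (hf m) (hf n))
    linear_combination -e0
  have R0 : ∀ m : Γ, (m : ℂ) ≠ 0 → f m * f (-m) = 1 ∧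
      m * (β m + β (-m)) = ((m : ℂ) ^ 3 - m) / 12 * k := by
    intro m hm
    have e0 := rel0 m 0
    have e1 := rel0 m 1
    simp only [hg, eval_mul, eval_C, eval_add, eval_X] at e0 e1
    have ef : f m * f (-m) = 1 := by
      apply mul_left_cancel₀ (mul_ne_zero two_ne_zero hm)
      linear_combination e1 - e0
    refine ⟨ef, ?_⟩
    linear_combination e0 - m * (β m + β (-m)) * ef
  have b1 : β (-o) = - β o := by
    have := (R0 o (by simp [ho1])).2
    simp [ho1] at this
    linear_combination this
  have B : ∀ m : Γ, (m : ℂ) ≠ 0 → (m : ℂ) ≠ 1 → (m : ℂ) ≠ -1 → (m : ℂ) ≠ -2 →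
      β m = m * β o := by
    intro m h0 h1 h2 h3
    have r1 := (R m o (by rw [ho1]; intro h; apply h2; linear_combination h)
      (by rw [ho1]; exact h1)).2
    have r2 := (R (m + o) (-o) (by simpa using h0)
      (by simp [ho1]; intro h; apply h3; linear_combination h)).2
    rw [add_neg_cancel_right, b1] at r2
    simp [ho1] at r1 r2
    linear_combination (-(m + 1 : ℂ) / 2) * r1 - ((m : ℂ) - 1) / 2 * r2
  have hk : k = 0 := by
    have v3 : ((3 • o : Γ) : ℂ) = 3 := by simp [ho1]
    have v3' : ((-(3 • o) : Γ) : ℂ) = -3 := by rw [NegMemClass.coe_neg, v3]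
    have p := B (3 • o) (by rw [v3]; norm_num) (by rw [v3]; norm_num) (by rw [v3]; norm_num)
      (by rw [v3]; norm_num)
    have q := B (-(3 • o)) (by rw [v3']; norm_num) (by rw [v3']; norm_num)
      (by rw [v3']; norm_num) (by rw [v3']; norm_num)
    have r := (R0 (3 • o) (by rw [v3]; norm_num)).2
    rw [p, q, v3, v3'] at r
    linear_combination -r / 2
  subst hk
  have odd : ∀ m : Γ, (m : ℂ) ≠ 0 → β (-m) = - β m := by
    intro m hm
    have := (R0 m hm).2
    rw [mul_zero] at this
    rcases mul_eq_zero.1 this with h | h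
    · exact absurd h hm
    · linear_combination h
  have Ball : ∀ m : Γ, β m = m * β o := by
    intro m
    by_cases h0 : (m : ℂ) = 0
    · rw [(hf0 m h0).2, h0]; simp
    by_cases h1 : (m : ℂ) = 1
    · have : m = o := Subtype.ext h1
      rw [this, ho1, one_mul]
    by_cases h2 : (m : ℂ) = -1
    · have : m = -o := Subtype.ext (by simp [h2, ho1])
      rw [this, b1]; simp [ho1]
    by_cases h3 : (m : ℂ) = -2
    · have p := B (-m) (by simpa using h0) (by simp [h3])
        (by simp [h3]; norm_num) (by simp [h3]; norm_num)
      rw [odd m h0] at p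
      simp at p
      exact p
    exact B m h0 h1 h2 h3
  refine ⟨by simp, f, hf, ?_, β o, fun m => by rw [hg m, Ball m]⟩
  have f0 : f 0 = 1 := (hf0 0 (by simp)).1
  intro m n
  by_cases hs : (m : ℂ) + n = 0
  · have : n = -m := by
      apply Subtype.ext; rw [NegMemClass.coe_neg]; linear_combination hs
    subst this
    rw [add_neg_cancel, f0]
    by_cases hm : (m : ℂ) = 0
    · have : m = 0 := Subtype.ext hm
      subst this; simp [f0]
    · exact (R0 m hm).1.symm
  by_cases hd : (m : ℂ) = n
  · have : m = n := Subtype.ext hd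
    subst this
    have hm : (m : ℂ) ≠ 0 := by intro h; apply hs; simp [h]
    have ne : ∀ i j : ℕ, i ≠ j → ((i • m : Γ) : ℂ) ≠ ((j • m : Γ) : ℂ) := by
      intro i j hij h
      simp [hm] at h
      exact hij h
    have ad : ∀ i j : ℕ, i ≠ j → i + j ≠ 0 → f ((i + j) • m) = f (i • m) * f (j • m) := by
      intro i j hij h0
      rw [add_smul]
      refine (R (i • m) (j • m) ?_ (ne i j hij)).1
      have := ne (i + j) 0 h0
      simpa [add_mul, add_smul] using this
    have a1 := ad 1 3 (by norm_num) (by norm_num)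
    have a2 := ad 1 4 (by norm_num) (by norm_num)
    have a3 := ad 2 3 (by norm_num) (by norm_num)
    norm_num at a1 a2 a3
    rw [← two_nsmul]
    apply mul_right_cancel₀ (hf (3 • m))
    linear_combination -a3 + a2 + f m * a1
  · exact (R m n hs hd).1

/-- Let `M` be a module over the `Γ`-Virasoro algebra `V_Γ` (given by the operators
`Lop m` for `m ∈ Γ` and the central operator `Cop`, subject to the Virasoro relations)
whose restriction to `ℂ[L₀]` is free of rank `1` (i.e. there is `v ∈ M` with
`P ↦ P(Lop 0) v` bijective). Then `C` acts by zero and `M ≅ Ω_Γ(f, α)` for some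
`f ∈ Γ^∨` and `α ∈ ℂ`. -/
theorem stmt7 (Γ : AddSubgroup ℂ) (h1 : (1 : ℂ) ∈ Γ)
    (M : Type) [AddCommGroup M] [Module ℂ M]
    (Lop : ↥Γ → Module.End ℂ M) (Cop : Module.End ℂ M)
    (hC : ∀ m : ↥Γ, Lop m * Cop = Cop * Lop m)
    (hL : ∀ m n : ↥Γ, Lop m * Lop n - Lop n * Lop m =
      ((m : ℂ) - (n : ℂ)) • Lop (m + n) +
        (if (m : ℂ) + (n : ℂ) = 0 then ((m : ℂ) ^ 3 - (m : ℂ)) / 12 else 0) • Cop)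
    (hfree : ∃ v : M, Function.Bijective fun P : Polynomial ℂ =>
      (Polynomial.aeval (Lop 0) P : Module.End ℂ M) v) :
    Cop = 0 ∧ ∃ f : ↥Γ → ℂ, (∀ m, f m ≠ 0) ∧ (∀ m n, f (m + n) = f m * f n) ∧
      ∃ (α : ℂ) (e : M ≃ₗ[ℂ] Polynomial ℂ),
        ∀ (m : ↥Γ) (x : M), e (Lop m x) = omegaAct Γ f α m (e x) := by
  obtain ⟨v, hv⟩ := hfree
  let E : ℂ[X] →ₗ[ℂ] M := (LinearMap.applyₗ v).comp (aeval (Lop 0)).toLinearMap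
  have hE : ∀ P, E P = (aeval (Lop 0) P : Module.End ℂ M) v := fun P => rfl
  let e : ℂ[X] ≃ₗ[ℂ] M := LinearEquiv.ofBijective E hv
  have he : ∀ P, e P = (aeval (Lop 0) P : Module.End ℂ M) v := fun P => rfl
  -- an operator commuting past `L₀` up to a shift commutes past all polynomials
  have comm : ∀ (T : Module.End ℂ M) (a : ℂ),
      T * Lop 0 = (Lop 0 + algebraMap ℂ _ a) * T → ∀ P : ℂ[X],
      T * aeval (Lop 0) P = aeval (Lop 0) (P.comp (X + C a)) * T := by
    intro T a h P
    induction P using Polynomial.induction_on' with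
    | add p q hp hq => simp only [map_add, add_comp, mul_add, add_mul, hp, hq]
    | monomial n r =>
      rw [← C_mul_X_pow_eq_monomial]
      simp only [map_mul, map_pow, aeval_X, aeval_C, mul_comp, C_comp, pow_comp, X_comp, map_add]
      have hp : T * (Lop 0) ^ n = (Lop 0 + algebraMap ℂ _ a) ^ n * T :=
        (show SemiconjBy T (Lop 0) (Lop 0 + algebraMap ℂ _ a) from h).pow_right n
      rw [← mul_assoc, ← Algebra.commutes r T, mul_assoc, hp, mul_assoc]
  have act : ∀ (T : Module.End ℂ M) (a : ℂ),
      T * Lop 0 = (Lop 0 + algebraMap ℂ _ a) * T → ∀ P : ℂ[X],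
      T (e P) = e (P.comp (X + C a) * e.symm (T v)) := by
    intro T a h P
    have := congrArg (fun S : Module.End ℂ M => S v) (comm T a h P)
    simp only [Module.End.mul_apply] at this
    rw [he P, this, he, map_mul, Module.End.mul_apply]
    congr 1
    rw [← he, LinearEquiv.apply_symm_apply]
  have cL : ∀ m : Γ, Lop m * Lop 0 = (Lop 0 + algebraMap ℂ _ (m : ℂ)) * Lop m := by
    intro m
    have h := hL m 0
    have hz : (if (m : ℂ) + ((0 : Γ) : ℂ) = 0 then ((m : ℂ) ^ 3 - (m : ℂ)) / 12 else 0) = 0 := by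
      split_ifs with h
      · simp at h; simp [h]
      · rfl
    rw [hz, zero_smul, add_zero, add_zero, sub_eq_iff_eq_add] at h
    rw [h, add_mul, ← Algebra.smul_def]
    simp [add_comm]
  have cC : Cop * Lop 0 = (Lop 0 + algebraMap ℂ _ 0) * Cop := by
    rw [map_zero, add_zero, hC]
  have actL := fun m => act _ _ (cL m)
  have actC := act _ _ cC
  simp only [C_0, add_zero, comp_X] at actC
  set g : Γ → ℂ[X] := fun m => e.symm (Lop m v) with hg
  set c : ℂ[X] := e.symm (Cop v) with hc
  have eg : ∀ m, Lop m v = e (g m) := fun m => by simp [hg]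
  have ec : Cop v = e c := by simp [hc]
  have hactL : ∀ (m : Γ) P, Lop m (e P) = e (P.comp (X + C (m : ℂ)) * g m) := actL
  obtain ⟨hc0, f, hf, hfm, α, hα⟩ := core_poly Γ h1 g c
    (by
      rw [hg]; simp only
      rw [LinearEquiv.symm_apply_eq, he, aeval_X])
    (by
      intro m
      have := congrArg (fun S : Module.End ℂ M => S v) (hC m)
      simp only [Module.End.mul_apply] at this
      rw [ec, eg, hactL, actC] at this
      exact e.injective this)
    (by
      intro m n
      have := congrArg (fun S : Module.End ℂ M => S v) (hL m n)
      simp only [Module.End.mul_apply, LinearMap.sub_apply, LinearMap.add_apply,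
        LinearMap.smul_apply] at this
      rw [ec, eg, eg, eg, hactL, hactL, ← map_sub, ← e.map_smul, ← e.map_smul, ← map_add] at this
      have := e.injective this
      rw [this, smul_eq_C_mul, smul_eq_C_mul])
  refine ⟨?_, f, hf, hfm, α, e.symm, ?_⟩
  · ext x
    obtain ⟨P, rfl⟩ := e.surjective x
    rw [actC, hc0]; simp
  · intro m x
    obtain ⟨P, rfl⟩ := e.surjective x
    rw [hactL, LinearEquiv.symm_apply_apply, LinearEquiv.symm_apply_apply, hα, omegaAct]
    ring
end

section
/- Let Γ be a subgroup of (ℂ, +) containing 1, g ∈ Γ^∨, α ∈ ℂ, and let φ_{a,f} be the automorphism of W_Γ given by φ_{a,f}(L_m) = a f(m) L_{m/a} (for f ∈ Γ^∨, a ∈ ℂ* with aΓ = Γ). Then the twist of Ω_Γ(g, α) by φ_{a,f} is isomorphic to Ω_Γ(g', α), where g' ∈ Γ^∨ is defined by g'(m) = f(m) g(m/a). -/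
open Polynomial

/-- The twist of `Ω_Γ(g, α)` by the automorphism `φ_{a,f}` of `W_Γ`
(`φ_{a,f}(L_m) = a f(m) L_{m/a}`; so the twisted action of `L_m` is
`(a f(m)) • (L_{m/a}-action)`) is isomorphic to `Ω_Γ(g', α)` with
`g'(m) = f(m) g(m/a)`. -/
theorem stmt9 (Γ : AddSubgroup ℂ) (h1 : (1 : ℂ) ∈ Γ)
    (g : ↥Γ → ℂ) (hg0 : ∀ m, g m ≠ 0) (hgadd : ∀ m n, g (m + n) = g m * g n) (α : ℂ)
    (a : ℂ) (ha0 : a ≠ 0) (ha : ∀ x : ℂ, x ∈ Γ ↔ a * x ∈ Γ)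
    (f : ↥Γ → ℂ) (hf0 : ∀ m, f m ≠ 0) (hfadd : ∀ m n, f (m + n) = f m * f n) :
    ∃ e : Polynomial ℂ ≃ₗ[ℂ] Polynomial ℂ,
      ∀ (m : ↥Γ) (P : Polynomial ℂ),
        e ((a * f m) • omegaAct Γ g α
            (⟨(m : ℂ) / a, (ha ((m : ℂ) / a)).mpr (by
              rw [show a * ((m : ℂ) / a) = (m : ℂ) by field_simp]; exact m.2)⟩ : ↥Γ) P)
          = omegaAct Γ
              (fun n : ↥Γ => f n * g (⟨(n : ℂ) / a, (ha ((n : ℂ) / a)).mpr (by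
                rw [show a * ((n : ℂ) / a) = (n : ℂ) by field_simp]; exact n.2)⟩ : ↥Γ))
              α m (e P) := by
  have hc : C a * C a⁻¹ = (1 : Polynomial ℂ) := by
    rw [← C_mul, mul_inv_cancel₀ ha0, C_1]
  have hc2 : ∀ P : Polynomial ℂ, C a * (C a⁻¹ * P) = P := fun P => by
    rw [← mul_assoc, hc, one_mul]
  have hc3 : ∀ P : Polynomial ℂ, C a⁻¹ * (C a * P) = P := fun P => by
    rw [← mul_assoc, mul_comm (C a⁻¹), hc, one_mul]
  let e : Polynomial ℂ ≃ₗ[ℂ] Polynomial ℂ :=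
    { toFun := fun P => P.comp (C a⁻¹ * X)
      invFun := fun P => P.comp (C a * X)
      map_add' := fun P Q => add_comp
      map_smul' := fun c P => by simp [smul_comp]
      left_inv := fun P => by
        simp only [comp_assoc, mul_comp, C_comp, X_comp, hc3, comp_X]
      right_inv := fun P => by
        simp only [comp_assoc, mul_comp, C_comp, X_comp, hc2, comp_X] }
  have he : ∀ P, e P = P.comp (C a⁻¹ * X) := fun P => rfl
  refine ⟨e, fun m P => ?_⟩
  rw [he, he]
  simp only [omegaAct, smul_comp, mul_comp, add_comp, C_comp, X_comp, comp_assoc, smul_eq_C_mul,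
    div_eq_mul_inv, C_mul, mul_add]
  rw [mul_comm (C a⁻¹) (C (m : ℂ))]
  linear_combination (C (f m) * C (g ⟨(m : ℂ) * a⁻¹, _⟩) * (X + C (m : ℂ) * C α) *
    P.comp (C a⁻¹ * X + C (m : ℂ) * C a⁻¹)) * hc
end

section
/- Let Γ be a subgroup of ℂ × ℤ₂, g ∈ Γ^∨, α ∈ ℂ, and let φ_{a,f} be the automorphism of sW_Γ given by φ_{a,f}(L_m) = a² f(m) L_{m/a²}, φ_{a,f}(G_r) = a f(r) G_{r/a²} (for f ∈ Γ^∨, a ∈ ℂ* with a²Γ = Γ and Re(a) ≥ 0). Then the twist of sΩ_Γ(g, α) by φ_{a,f} is isomorphic to sΩ_Γ(g', α), where g' ∈ Γ^∨ is defined by g'(m) = f(m) g(m/a²). -/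
open Polynomial

/-- The twist of `sΩ_Γ(g, α)` by the automorphism `φ_{a,f}` of `sW_Γ`
(`φ_{a,f}(L_m) = a² f(m) L_{m/a²}`, `φ_{a,f}(G_r) = a f(r) G_{r/a²}`; so the twisted
action of the basis element indexed by `p` is `a² f(p)` resp. `a f(p)` times the
action of the basis element indexed by `(p₁/a², p₂)`) is isomorphic, via an even
isomorphism of `sW_Γ`-modules, to `sΩ_Γ(g', α)` with `g'(p) = f(p) g(p₁/a², p₂)`. -/
theorem stmt10 (Γ : AddSubgroup (ℂ × ZMod 2))
    (g : ↥Γ → ℂ) (hg0 : ∀ p, g p ≠ 0) (hgadd : ∀ p q, g (p + q) = g p * g q) (α : ℂ)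
    (a : ℂ) (ha0 : a ≠ 0) (hare : 0 ≤ a.re)
    (ha : ∀ q : ℂ × ZMod 2, q ∈ Γ ↔ ((a ^ 2 * q.1, q.2) : ℂ × ZMod 2) ∈ Γ)
    (f : ↥Γ → ℂ) (hf0 : ∀ p, f p ≠ 0) (hfadd : ∀ p q, f (p + q) = f p * f q) :
    ∃ e : (Polynomial ℂ × Polynomial ℂ) ≃ₗ[ℂ] (Polynomial ℂ × Polynomial ℂ),
      (∀ P : Polynomial ℂ, (e (P, 0)).2 = 0) ∧
      (∀ Q : Polynomial ℂ, (e (0, Q)).1 = 0) ∧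
      ∀ (p : ↥Γ) (v : Polynomial ℂ × Polynomial ℂ),
        e ((if (p : ℂ × ZMod 2).2 = 0 then a ^ 2 * f p else a * f p) •
            sOmegaAct Γ g α
              (⟨((p : ℂ × ZMod 2).1 / a ^ 2, (p : ℂ × ZMod 2).2),
                (ha ((p : ℂ × ZMod 2).1 / a ^ 2, (p : ℂ × ZMod 2).2)).mpr (by
                  rw [show a ^ 2 * ((p : ℂ × ZMod 2).1 / a ^ 2) = (p : ℂ × ZMod 2).1 by
                    field_simp]
                  exact p.2)⟩ : ↥Γ) v)
          = sOmegaAct Γ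
              (fun q : ↥Γ => f q * g
                (⟨((q : ℂ × ZMod 2).1 / a ^ 2, (q : ℂ × ZMod 2).2),
                  (ha ((q : ℂ × ZMod 2).1 / a ^ 2, (q : ℂ × ZMod 2).2)).mpr (by
                    rw [show a ^ 2 * ((q : ℂ × ZMod 2).1 / a ^ 2) = (q : ℂ × ZMod 2).1 by
                      field_simp]
                    exact q.2)⟩ : ↥Γ))
              α p (e v) := by
  have ha2 : a ^ 2 ≠ 0 := pow_ne_zero 2 ha0
  let e : (Polynomial ℂ × Polynomial ℂ) ≃ₗ[ℂ] (Polynomial ℂ × Polynomial ℂ) :=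
    { toFun := fun v => (v.1.comp (C (a ^ 2)⁻¹ * X), C a⁻¹ * v.2.comp (C (a ^ 2)⁻¹ * X))
      invFun := fun v => (v.1.comp (C (a ^ 2) * X), C a * v.2.comp (C (a ^ 2) * X))
      map_add' := by
        intro v w
        ext1 <;> simp [mul_add]
      map_smul' := by
        intro c v
        ext1 <;> simp
      left_inv := by
        intro v
        have h : (C (a ^ 2)⁻¹ * (C (a ^ 2) * X) : Polynomial ℂ) = X := by
          rw [← mul_assoc, ← C_mul, inv_mul_cancel₀ ha2, C_1, one_mul]
        ext1
        · simp only [comp_assoc, mul_comp, C_comp, X_comp, h, comp_X]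
        · simp only [comp_assoc, mul_comp, C_comp, X_comp, h, comp_X]
          rw [← mul_assoc, ← C_mul, mul_inv_cancel₀ ha0, C_1, one_mul]
      right_inv := by
        intro v
        have h : (C (a ^ 2) * (C (a ^ 2)⁻¹ * X) : Polynomial ℂ) = X := by
          rw [← mul_assoc, ← C_mul, mul_inv_cancel₀ ha2, C_1, one_mul]
        ext1
        · simp only [comp_assoc, mul_comp, C_comp, X_comp, h, comp_X]
        · simp only [comp_assoc, mul_comp, C_comp, X_comp, h, comp_X]
          rw [← mul_assoc, ← C_mul, inv_mul_cancel₀ ha0, C_1, one_mul] }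
  have he : ∀ v, e v = (v.1.comp (C (a ^ 2)⁻¹ * X), C a⁻¹ * v.2.comp (C (a ^ 2)⁻¹ * X)) :=
    fun v => rfl
  refine ⟨e, fun P => by simp [he], fun Q => by simp [he], ?_⟩
  intro p v
  have hl : ∀ m : ℂ, (C (a ^ 2)⁻¹ * X + C (m / a ^ 2) : Polynomial ℂ)
      = C (a ^ 2)⁻¹ * (X + C m) := by
    intro m
    rw [mul_add, ← C_mul, div_eq_inv_mul]
  rw [he, he]
  by_cases hp : (p : ℂ × ZMod 2).2 = 0
  · simp only [sOmegaAct, hp, if_true]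
    generalize g _ = G
    ext1
    · simp only [Prod.smul_mk, smul_comp, smul_eq_C_mul, comp_assoc, mul_comp, C_comp, X_comp,
        add_comp, hl, div_mul_eq_mul_div]
      generalize v.1.comp _ = P
      have : (C (a ^ 2) * C (a ^ 2)⁻¹ : Polynomial ℂ) = 1 := by
        rw [← C_mul, mul_inv_cancel₀ ha2, C_1]
      rw [C_mul (a := a ^ 2), C_mul (a := f p)]
      linear_combination (C (f p) * C G * (X + C ((p : ℂ × ZMod 2).1 * α)) * P) * this
    · simp only [Prod.smul_mk, smul_comp, smul_eq_C_mul, comp_assoc, mul_comp, C_comp, X_comp,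
        add_comp, hl, div_mul_eq_mul_div]
      generalize v.2.comp _ = P
      have : (C (a ^ 2) * C (a ^ 2)⁻¹ : Polynomial ℂ) = 1 := by
        rw [← C_mul, mul_inv_cancel₀ ha2, C_1]
      rw [C_mul (a := a ^ 2), C_mul (a := f p)]
      linear_combination
        (C a⁻¹ * C (f p) * C G * (X + C ((p : ℂ × ZMod 2).1 * (α + 1 / 2))) * P) * this
  · simp only [sOmegaAct, hp, if_false]
    generalize g _ = G
    ext1
    · simp only [Prod.smul_mk, smul_comp, smul_eq_C_mul, comp_assoc, mul_comp, C_comp, X_comp,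
        add_comp, hl, div_mul_eq_mul_div, mul_div_assoc']
      generalize v.2.comp _ = P
      have : (C a * C (a ^ 2)⁻¹ : Polynomial ℂ) = C a⁻¹ := by
        rw [← C_mul]
        congr 1
        field_simp
      rw [C_mul (a := a), C_mul (a := f p)]
      linear_combination (C (f p) * C G * (X + C (2 * (p : ℂ × ZMod 2).1 * α)) * P) * this
    · simp only [Prod.smul_mk, smul_comp, smul_eq_C_mul, comp_assoc, mul_comp, C_comp, X_comp,
        add_comp, hl]
      generalize v.1.comp _ = P
      have : (C a⁻¹ * C a : Polynomial ℂ) = 1 := by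
        rw [← C_mul, inv_mul_cancel₀ ha0, C_1]
      rw [C_mul (a := a), C_mul (a := f p)]
      linear_combination (C (f p) * C G * P) * this
end

section
/- Let Γ be a subgroup of (ℂ, +) containing 1, f ∈ Γ^∨ and α ∈ ℂ. The W_Γ-module Ω_Γ(f, α) is simple if and only if α ≠ 0. -/
open Polynomial

/-- The `W_Γ`-module `Ω_Γ(f, α)` is simple (has no invariant subspaces other than
`⊥` and `⊤`) if and only if `α ≠ 0`. -/
theorem stmt11 (Γ : AddSubgroup ℂ) (h1 : (1 : ℂ) ∈ Γ)
    (f : ↥Γ → ℂ) (hf0 : ∀ m, f m ≠ 0) (hfadd : ∀ m n, f (m + n) = f m * f n) (α : ℂ) :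
    (∀ N : Submodule ℂ (Polynomial ℂ),
      (∀ (m : ↥Γ) (P : Polynomial ℂ), P ∈ N → omegaAct Γ f α m P ∈ N) →
      N = ⊥ ∨ N = ⊤) ↔ α ≠ 0 := by
  constructor
  · rintro h rfl
    rcases h ((Ideal.span {(X : ℂ[X])}).restrictScalars ℂ) (by
      intro m P _
      simp only [Submodule.restrictScalars_mem, Ideal.mem_span_singleton, omegaAct]
      simp only [mul_zero, C_0, add_zero]
      exact Dvd.dvd.mul_right (Dvd.intro_left _ rfl) _) with h | h
    · have hX : (X : ℂ[X]) ∈ (Ideal.span {(X : ℂ[X])}).restrictScalars ℂ := by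
        simp [Ideal.mem_span_singleton]
      rw [h, Submodule.mem_bot] at hX
      exact X_ne_zero hX
    · have hX : (1 : ℂ[X]) ∈ (Ideal.span {(X : ℂ[X])}).restrictScalars ℂ := by
        rw [h]; trivial
      rw [Submodule.restrictScalars_mem, Ideal.mem_span_singleton] at hX
      exact not_isUnit_X (isUnit_of_dvd_one hX)
  · intro hα N hN
    by_contra! hcon
    obtain ⟨hbot, htop⟩ := hcon
    have hXmul : ∀ P ∈ N, X * P ∈ N := by
      intro P hP
      have h := N.smul_mem (f 0)⁻¹ (hN 0 P hP)
      have e : (f 0)⁻¹ • omegaAct Γ f α 0 P = X * P := by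
        simp only [omegaAct, smul_eq_C_mul, ← mul_assoc, ← C_mul, inv_mul_cancel₀ (hf0 0)]
        simp
      rwa [e] at h
    have hmul : ∀ Q P : ℂ[X], P ∈ N → Q * P ∈ N := by
      intro Q P hP
      induction Q using Polynomial.induction_on' with
      | add p q hp hq => rw [add_mul]; exact N.add_mem hp hq
      | monomial n a =>
        rw [← C_mul_X_pow_eq_monomial, mul_assoc, ← smul_eq_C_mul]
        apply N.smul_mem
        induction n with
        | zero => simpa using hP
        | succ k ih => rw [pow_succ', mul_assoc]; exact hXmul _ ih
    let I : Ideal ℂ[X] :=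
      { carrier := N
        add_mem' := fun ha hb => N.add_mem ha hb
        zero_mem' := N.zero_mem
        smul_mem' := fun Q P hP => hmul Q P hP }
    have hI : ∀ P, P ∈ I ↔ P ∈ N := fun P => Iff.rfl
    obtain ⟨P, hP, hP0⟩ := N.ne_bot_iff.1 hbot
    obtain ⟨g, hg⟩ := (IsPrincipalIdealRing.principal I).principal
    have hg' : ∀ Q, Q ∈ N ↔ g ∣ Q := by
      intro Q
      rw [← hI, hg]
      exact Ideal.mem_span_singleton
    have hgdeg : g.degree ≠ 0 := by
      intro h0
      apply htop
      rw [eq_top_iff]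
      intro Q _
      exact (hg' Q).2 ((isUnit_iff_degree_eq_zero.2 h0).dvd)
    obtain ⟨a, ha⟩ := IsAlgClosed.exists_root g hgdeg
    have key : ∀ m : ℤ, (a + m * α) ≠ 0 → P.IsRoot (a + m) := by
      intro m hm
      have hmem : (m : ℂ) ∈ Γ := by
        have := Γ.zsmul_mem h1 m
        simpa using this
      have h := ha.dvd ((hg' _).1 (hN ⟨m, hmem⟩ P hP))
      simpa [omegaAct, IsRoot, hf0, hm] using h
    have hfin : {x | P.IsRoot x}.Finite := finite_setOf_isRoot hP0
    have hinj : Function.Injective (fun m : ℤ => a + (m : ℂ)) := by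
      intro m n h
      simpa using h
    have hfin2 := hfin.preimage (hinj.injOn)
    have hbad : {m : ℤ | a + m * α = 0}.Finite := by
      apply Set.Subsingleton.finite
      intro m hm n hn
      have : (m : ℂ) * α = n * α := by
        have h3 : a + (m : ℂ) * α = a + n * α := hm.trans hn.symm
        exact add_left_cancel h3
      exact_mod_cast mul_right_cancel₀ hα this
    apply Set.infinite_univ (α := ℤ)
    apply (hfin2.union hbad).subset
    intro m _
    by_cases hm : a + (m : ℂ) * α = 0
    · exact Or.inr hm
    · exact Or.inl (key m hm)
end

section
/- Let Γ be a subgroup of (ℂ, +) containing 1 and f ∈ Γ^∨. The W_Γ-module Ω_Γ(f, 0) has a unique nonzero proper submodule N, namely the set of polynomials in ℂ[L_0] with zero constant term; N is simple, N is isomorphic to Ω_Γ(f, 1) as a W_Γ-module, and the quotient Ω_Γ(f, 0)/N is a one-dimensional trivial W_Γ-module. -/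
open Polynomial

/-- The subspace of `Ω_Γ(f, 0) = ℂ[L₀]` consisting of the polynomials with zero
constant term. -/
noncomputable def constTermZero : Submodule ℂ (Polynomial ℂ) :=
  LinearMap.ker (lcoeff ℂ 0)

theorem mem_ctz (P : Polynomial ℂ) : P ∈ constTermZero ↔ P.coeff 0 = 0 := by
  simp [constTermZero, LinearMap.mem_ker, lcoeff_apply]

theorem shift_const (P : Polynomial ℂ) (h : P.comp (X + C 1) = P) : P = C (P.eval 0) := by
  have hn : ∀ n : ℕ, P.eval (n : ℂ) = P.eval 0 := by
    intro n
    induction n with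
    | zero => simp
    | succ k ih =>
      rw [← ih]
      conv_rhs => rw [← h]
      simp [eval_comp]
  apply Polynomial.eq_of_infinite_eval_eq
  refine Set.Infinite.mono ?_ (Set.infinite_range_of_injective (Nat.cast_injective (R := ℂ)))
  rintro _ ⟨n, rfl⟩
  simp [hn n]

theorem one_mem_of_shift (S : Submodule ℂ (Polynomial ℂ))
    (hS : ∀ P ∈ S, P.comp (X + C 1) ∈ S) (d : ℕ) :
    ∀ P ∈ S, P ≠ 0 → P.natDegree < d → (1 : Polynomial ℂ) ∈ S := by
  induction d with
  | zero => intro P _ _ h; omega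
  | succ d ih =>
    intro P hP h0 hd
    by_cases hc : P.comp (X + C 1) = P
    · have h := shift_const P hc
      have hne : P.eval 0 ≠ 0 := by
        intro h2
        rw [h2] at h
        exact h0 (by simpa using h)
      have := S.smul_mem (P.eval 0)⁻¹ hP
      rw [h, smul_C] at this
      simpa [hne] using this
    · have hsub : P.comp (X + C 1) - P ≠ 0 := sub_ne_zero.mpr hc
      refine ih _ (S.sub_mem (hS P hP) hP) hsub ?_
      have hlt : (P.comp (X + C 1) - P).degree < (P.comp (X + C 1)).degree := by
        have e : P.comp (X + C 1) = taylor 1 P := by simp [taylor_apply]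
        rw [e] at *
        apply degree_sub_lt
        · simp
        · simpa using h0
        · simp
      have h3 := natDegree_lt_natDegree hsub hlt
      have h4 : (P.comp (X + C 1)).natDegree = P.natDegree := by
        rw [natDegree_comp, natDegree_X_add_C, mul_one]
      omega

theorem ctz_le (Γ : AddSubgroup ℂ) (h1 : (1 : ℂ) ∈ Γ)
    (f : ↥Γ → ℂ) (hf0 : ∀ m, f m ≠ 0) (N : Submodule ℂ (Polynomial ℂ))
    (hN : ∀ (m : ↥Γ) (P : Polynomial ℂ), P ∈ N → omegaAct Γ f 0 m P ∈ N)
    (hne : N ≠ ⊥) : constTermZero ≤ N := by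
  have key : ∀ (m : ↥Γ) (P : Polynomial ℂ), P ∈ N → X * P.comp (X + C (m : ℂ)) ∈ N := by
    intro m P hP
    have h := N.smul_mem (f m)⁻¹ (hN m P hP)
    have e : (f m)⁻¹ • omegaAct Γ f 0 m P = X * P.comp (X + C (m : ℂ)) := by
      rw [omegaAct, smul_eq_C_mul, ← mul_assoc, ← mul_assoc, ← C_mul, inv_mul_cancel₀ (hf0 m)]
      simp
    rwa [e] at h
  have hX : ∀ P ∈ N, X * P ∈ N := by
    intro P hP
    simpa using key 0 P hP
  let S : Submodule ℂ (Polynomial ℂ) :=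
    { carrier := {P | ∀ m : ↥Γ, X * P.comp (X + C (m : ℂ)) ∈ N}
      add_mem' := by
        intro a b ha hb m
        rw [add_comp, mul_add]
        exact N.add_mem (ha m) (hb m)
      zero_mem' := by intro m; simp
      smul_mem' := by
        intro c P hP m
        rw [smul_comp, mul_smul_comm]
        exact N.smul_mem c (hP m) }
  obtain ⟨P, hP, hP0⟩ := N.ne_bot_iff.mp hne
  have h1S : (1 : Polynomial ℂ) ∈ S := by
    refine one_mem_of_shift S ?_ (P.natDegree + 1) P (fun m => key m P hP) hP0 (by omega)
    intro Q hQ m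
    have h := hQ (m + ⟨1, h1⟩)
    have e : (Q.comp (X + C 1)).comp (X + C (m : ℂ))
        = Q.comp (X + C ((m + ⟨1, h1⟩ : ↥Γ) : ℂ)) := by
      rw [comp_assoc]
      congr 1
      simp [add_assoc]
    rw [e]
    exact h
  have hXN : (X : Polynomial ℂ) ∈ N := by
    have := h1S 0
    simpa using this
  have hpow : ∀ n : ℕ, (X : Polynomial ℂ) ^ n * X ∈ N := by
    intro n
    induction n with
    | zero => simpa using hXN
    | succ k ih =>
      have := hX _ ih
      rwa [← mul_assoc, ← pow_succ'] at this
  have hall : ∀ Q : Polynomial ℂ, Q * X ∈ N := by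
    intro Q
    induction Q using Polynomial.induction_on' with
    | add p q hp hq => rw [add_mul]; exact N.add_mem hp hq
    | monomial n a =>
      rw [← C_mul_X_pow_eq_monomial, mul_assoc, ← smul_eq_C_mul]
      exact N.smul_mem a (hpow n)
  intro Q hQ
  rw [mem_ctz] at hQ
  obtain ⟨R, rfl⟩ := X_dvd_iff.mpr hQ
  rw [mul_comm]
  exact hall R

theorem act_mem (Γ : AddSubgroup ℂ) (f : ↥Γ → ℂ) (m : ↥Γ) (P : Polynomial ℂ) :
    omegaAct Γ f 0 m P ∈ constTermZero := by
  rw [mem_ctz]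
  simp [omegaAct, mul_coeff_zero]

/-- `Ω_Γ(f, 0)` has a unique nonzero proper submodule `N`, namely the polynomials with
zero constant term; `N` is simple, `N ≅ Ω_Γ(f, 1)` as `W_Γ`-modules, and the quotient
`Ω_Γ(f, 0)/N` is a one-dimensional trivial `W_Γ`-module. -/
theorem stmt12 (Γ : AddSubgroup ℂ) (h1 : (1 : ℂ) ∈ Γ)
    (f : ↥Γ → ℂ) (hf0 : ∀ m, f m ≠ 0) (hfadd : ∀ m n, f (m + n) = f m * f n) :
    (∀ P : Polynomial ℂ, P ∈ constTermZero ↔ P.coeff 0 = 0) ∧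
    -- `N` is an invariant nonzero proper submodule
    (∀ (m : ↥Γ) (P : Polynomial ℂ), P ∈ constTermZero → omegaAct Γ f 0 m P ∈ constTermZero) ∧
    constTermZero ≠ ⊥ ∧ constTermZero ≠ ⊤ ∧
    -- uniqueness: any nonzero proper invariant submodule equals `N`
    (∀ N : Submodule ℂ (Polynomial ℂ),
      (∀ (m : ↥Γ) (P : Polynomial ℂ), P ∈ N → omegaAct Γ f 0 m P ∈ N) →
      N ≠ ⊥ → N ≠ ⊤ → N = constTermZero) ∧
    -- `N` is a simple `W_Γ`-module
    (∀ N : Submodule ℂ (Polynomial ℂ), N ≤ constTermZero →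
      (∀ (m : ↥Γ) (P : Polynomial ℂ), P ∈ N → omegaAct Γ f 0 m P ∈ N) →
      N = ⊥ ∨ N = constTermZero) ∧
    -- `N ≅ Ω_Γ(f, 1)` as `W_Γ`-modules
    (∃ e : Polynomial ℂ ≃ₗ[ℂ] ↥constTermZero,
      ∀ (m : ↥Γ) (P : Polynomial ℂ),
        (e (omegaAct Γ f 1 m P) : Polynomial ℂ) = omegaAct Γ f 0 m (e P)) ∧
    -- the quotient is a trivial module …
    (∀ (m : ↥Γ) (P : Polynomial ℂ), omegaAct Γ f 0 m P ∈ constTermZero) ∧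
    -- … of dimension one
    Module.finrank ℂ (Polynomial ℂ ⧸ constTermZero) = 1 := by
  refine ⟨mem_ctz, fun m P _ => act_mem Γ f m P, ?_, ?_, ?_, ?_, ?_, act_mem Γ f, ?_⟩
  · rw [Submodule.ne_bot_iff]
    exact ⟨X, by simp [mem_ctz], X_ne_zero⟩
  · intro h
    have : (1 : Polynomial ℂ) ∈ constTermZero := by rw [h]; trivial
    rw [mem_ctz] at this
    simp at this
  · intro N hN hb ht
    have hle := ctz_le Γ h1 f hf0 N hN hb
    refine le_antisymm ?_ hle
    intro P hP
    rw [mem_ctz]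
    by_contra hc
    apply ht
    rw [eq_top_iff]
    intro Q _
    have h : Q - (Q.coeff 0 / P.coeff 0) • P ∈ N := by
      apply hle
      rw [mem_ctz]
      simp [hc]
    have := N.add_mem h (N.smul_mem (Q.coeff 0 / P.coeff 0) hP)
    simpa using this
  · intro N hle hN
    by_cases hb : N = ⊥
    · exact Or.inl hb
    · exact Or.inr (le_antisymm hle (ctz_le Γ h1 f hf0 N hN hb))
  · let g : Polynomial ℂ →ₗ[ℂ] ↥constTermZero :=
      LinearMap.codRestrict constTermZero (LinearMap.mulLeft ℂ (X : Polynomial ℂ))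
        (fun P => by rw [mem_ctz]; simp)
    have hg : ∀ P, (g P : Polynomial ℂ) = X * P := fun P => rfl
    have hb : Function.Bijective g := by
      constructor
      · intro P Q h
        have h2 : (g P : Polynomial ℂ) = g Q := by rw [h]
        rw [hg, hg] at h2
        exact mul_left_cancel₀ X_ne_zero h2
      · rintro ⟨Q, hQ⟩
        obtain ⟨R, rfl⟩ := X_dvd_iff.mpr ((mem_ctz Q).mp hQ)
        exact ⟨R, Subtype.ext (hg R)⟩
    refine ⟨LinearEquiv.ofBijective g hb, ?_⟩
    intro m P
    rw [LinearEquiv.ofBijective_apply, LinearEquiv.ofBijective_apply, hg, hg]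
    simp only [omegaAct, mul_comp, X_comp, mul_one, mul_zero, C_0, add_zero]
    ring
  · have hs : Function.Surjective (lcoeff ℂ 0) := fun c => ⟨C c, by simp⟩
    have := ((lcoeff ℂ 0).quotKerEquivOfSurjective hs).finrank_eq
    rw [Module.finrank_self] at this
    exact this
end

section
/- Let Γ be a subgroup of ℂ × ℤ₂ and f ∈ Γ^∨. The map ψ: Π(sΩ_Γ(f, 1/2)) → sΩ_Γ(f, 0) defined by ψ(P(L_0)) = L_0 P(L_0) on the part generated by 1 and ψ(P(L_0) ξ) = P(L_0) ξ' on the part generated by ξ (where 1, ξ and 1', ξ' are the free ℂ[L_0]-generators of the two homogeneous parts of the source and target respectively) is an injective homomorphism of sW_Γ-modules. -/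
open Polynomial

/-- The map `ψ : Π(sΩ_Γ(f, 1/2)) → sΩ_Γ(f, 0)` sending the part generated by the even
generator `1` of `Π(sΩ_Γ(f, 1/2))` (which is the `ξ`-component of `sΩ_Γ(f, 1/2)`,
i.e. the second coordinate) via `P(L₀) ↦ L₀ P(L₀) ⬝ 1'` and the part generated by the
odd generator `ξ` (the first coordinate) via `P(L₀) ↦ P(L₀) ξ'`; in coordinates
`ψ(P, Q) = (L₀ Q, P)`. It is an injective homomorphism of `sW_Γ`-modules. -/
theorem stmt16 (Γ : AddSubgroup (ℂ × ZMod 2))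
    (f : ↥Γ → ℂ) (hf0 : ∀ p, f p ≠ 0) (hfadd : ∀ p q, f (p + q) = f p * f q) :
    Function.Injective
      (fun v : Polynomial ℂ × Polynomial ℂ => ((X * v.2, v.1) : Polynomial ℂ × Polynomial ℂ)) ∧
    ∀ (p : ↥Γ) (v : Polynomial ℂ × Polynomial ℂ),
      ((X * (sOmegaAct Γ f (1 / 2) p v).2, (sOmegaAct Γ f (1 / 2) p v).1)
          : Polynomial ℂ × Polynomial ℂ)
        = sOmegaAct Γ f 0 p (X * v.2, v.1) := by
  refine ⟨?_, ?_⟩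
  · rintro ⟨a, b⟩ ⟨c, d⟩ h
    simp only [Prod.mk.injEq] at h
    obtain ⟨h1, h2⟩ := h
    have h3 : b = d := mul_left_cancel₀ X_ne_zero h1
    rw [h2, h3]
  · intro p v
    have e1 : (1 / 2 + 1 / 2 : ℂ) = 1 := by norm_num
    have e2 : 2 * (p : ℂ × ZMod 2).1 * (1 / 2) = (p : ℂ × ZMod 2).1 := by ring
    unfold sOmegaAct
    split_ifs with h
    · simp only [e1, mul_one, mul_zero, zero_add, C_0, add_zero, mul_comp, X_comp]
      refine Prod.ext ?_ rfl
      ring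
    · simp only [e2, mul_zero, C_0, add_zero, mul_comp, X_comp]
      refine Prod.ext ?_ ?_ <;> ring
end

section
/- Let Γ be a subgroup of (ℂ, +) containing 1, α ∈ ℂ, and let f̃ ∈ Γ^∨ be a homomorphism that extends to a group homomorphism f: (ℂ, +) → (ℂ*, ·) with f|_Γ = f̃. Then the weighted module W(Ω_Γ(f̃, α)) is isomorphic as a W_Γ-module to the intermediate series module V_ℂ(1 − α). -/
open Polynomial DirectSum

open scoped Classical

/-- For `z ∈ ℂ` (i.e. the weight `μ_z ∈ h*`, `L₀ ↦ z`), the subspace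
`ker(μ̄_z)·M = (X - z)·ℂ[X]` of `M = Ω_Γ(f, α) = ℂ[L₀] = ℂ[X]`. -/
noncomputable def kerWeight (z : ℂ) : Submodule ℂ (Polynomial ℂ) :=
  LinearMap.range (LinearMap.mulLeft ℂ ((X : Polynomial ℂ) - C z))

/-- The action of `L_m` on `Ω_Γ(f, α)` as a linear map:
`L_m ⬝ P(L₀) = f(m) (L₀ + m α) P(L₀ + m)`. -/
noncomputable def omegaActL (Γ : AddSubgroup ℂ) (f : ↥Γ → ℂ) (α : ℂ) (m : ↥Γ) :
    Polynomial ℂ →ₗ[ℂ] Polynomial ℂ :=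
  (LinearMap.mulLeft ℂ (C (f m) * (X + C ((m : ℂ) * α)))).comp
    (Polynomial.aeval (R := ℂ) (X + C (m : ℂ))).toLinearMap

lemma kerWeight_le (Γ : AddSubgroup ℂ) (f : ↥Γ → ℂ) (α : ℂ) (m : ↥Γ) (z : ℂ) :
    kerWeight z ≤ (kerWeight (z - (m : ℂ))).comap (omegaActL Γ f α m) := by
  rintro u ⟨Q, rfl⟩
  refine ⟨C (f m) * (X + C ((m : ℂ) * α)) * Q.comp (X + C (m : ℂ)), ?_⟩
  simp only [LinearMap.mulLeft_apply, omegaActL, LinearMap.comp_apply,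
    AlgHom.toLinearMap_apply, ← comp_eq_aeval, mul_comp, sub_comp, X_comp, C_comp, C_sub, C_mul]
  ring

/-- The underlying space of the weighted module `W(Ω_Γ(f, α))`:
`⊕_{z ∈ ℂ} M/ker(μ̄_z)M`. -/
noncomputable abbrev weightedSpace : Type :=
  ⨁ z : ℂ, (Polynomial ℂ ⧸ kerWeight z)

/-- The action of `L_m` on the weighted module `W(Ω_Γ(f, α))`: since `L_m ∈ (W_Γ)_{-m}`
for the adjoint action of `h = ℂL₀`, it maps the `z`-component `M/ker(μ̄_z)M` into the
`(z-m)`-component, by `v + ker(μ̄_z)M ↦ L_m v + ker(μ̄_{z-m})M`. -/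
noncomputable def weightedAct (Γ : AddSubgroup ℂ) (f : ↥Γ → ℂ) (α : ℂ) (m : ↥Γ) :
    weightedSpace →ₗ[ℂ] weightedSpace :=
  DirectSum.toModule ℂ ℂ weightedSpace fun z =>
    (DirectSum.lof ℂ ℂ (fun w => Polynomial ℂ ⧸ kerWeight w) (z - (m : ℂ))).comp
      (Submodule.mapQ (kerWeight z) (kerWeight (z - (m : ℂ))) (omegaActL Γ f α m)
        (kerWeight_le Γ f α m z))

/-- The action of `L_m` on the intermediate series module `V_ℂ(a)` with basis
`{v_k}_{k ∈ ℂ}` (here `v_k = Finsupp.single k 1`): `L_m v_k = (k - a m) v_{k-m}`. -/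
noncomputable def interAct (a m : ℂ) (x : ℂ →₀ ℂ) : ℂ →₀ ℂ :=
  x.sum fun k c => (c * (k - a * m)) • Finsupp.single (k - m) (1 : ℂ)

lemma kerWeight_eq_ker (z c : ℂ) (hc : c ≠ 0) :
    kerWeight z = LinearMap.ker (c • (Polynomial.leval z : Polynomial ℂ →ₗ[ℂ] ℂ)) := by
  ext P
  simp only [kerWeight, LinearMap.mem_range, LinearMap.mulLeft_apply, LinearMap.mem_ker,
    LinearMap.smul_apply, Polynomial.leval_apply, smul_eq_mul, mul_eq_zero, hc, false_or]
  constructor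
  · rintro ⟨Q, rfl⟩
    simp
  · intro h
    obtain ⟨Q, hQ⟩ := Polynomial.dvd_iff_isRoot.mpr h
    exact ⟨Q, hQ.symm⟩

lemma leval_smul_surj (z c : ℂ) (hc : c ≠ 0) :
    Function.Surjective (c • (Polynomial.leval z : Polynomial ℂ →ₗ[ℂ] ℂ)) := by
  intro y
  refine ⟨C (c⁻¹ * y), ?_⟩
  simp [hc]

/-- The scaled evaluation isomorphism on the `z`-component. -/
noncomputable def compEquiv (z c : ℂ) (hc : c ≠ 0) : (Polynomial ℂ ⧸ kerWeight z) ≃ₗ[ℂ] ℂ :=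
  (Submodule.quotEquivOfEq _ _ (kerWeight_eq_ker z c hc)).trans
    (LinearMap.quotKerEquivOfSurjective _ (leval_smul_surj z c hc))

lemma compEquiv_mk (z c : ℂ) (hc : c ≠ 0) (P : Polynomial ℂ) :
    compEquiv z c hc (Submodule.Quotient.mk P) = c * P.eval z := by
  rfl

/-- The isomorphism of the theorem. -/
noncomputable def weightEquiv (f : ℂ → ℂ) (hf0 : ∀ x, f x ≠ 0) : weightedSpace ≃ₗ[ℂ] (ℂ →₀ ℂ) :=
  (DFinsupp.mapRange.linearEquiv (fun z => compEquiv z (f z) (hf0 z))).trans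
    (finsuppLequivDFinsupp (ι := ℂ) (M := ℂ) ℂ).symm

lemma weightEquiv_lof (f : ℂ → ℂ) (hf0 : ∀ x, f x ≠ 0) (z : ℂ) (P : Polynomial ℂ) :
    weightEquiv f hf0 (DirectSum.lof ℂ ℂ (fun w => Polynomial ℂ ⧸ kerWeight w) z
      (Submodule.Quotient.mk P)) = Finsupp.single z (f z * P.eval z) := by
  rw [← compEquiv_mk z (f z) (hf0 z) P, weightEquiv, LinearEquiv.trans_apply,
    LinearEquiv.symm_apply_eq]
  refine (DFinsupp.mapRange_single (f := fun z => compEquiv z (f z) (hf0 z))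
    (hf := fun z => map_zero _) (i := z) (b := Submodule.Quotient.mk P)).trans ?_
  exact (Finsupp.toDFinsupp_single z _).symm

lemma interAct_add (a m : ℂ) (x y : ℂ →₀ ℂ) :
    interAct a m (x + y) = interAct a m x + interAct a m y := by
  unfold interAct
  apply Finsupp.sum_add_index'
  · intro k; simp
  · intro k b c; rw [add_mul, add_smul]

/-- If `f̃ ∈ Γ^∨` extends to a homomorphism `f : (ℂ, +) → (ℂ*, ·)`, then
`W(Ω_Γ(f̃, α)) ≅ V_ℂ(1 - α)` as `W_Γ`-modules. -/
theorem stmt17 (Γ : AddSubgroup ℂ) (h1 : (1 : ℂ) ∈ Γ) (α : ℂ)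
    (ftil : ↥Γ → ℂ) (hftil0 : ∀ m, ftil m ≠ 0)
    (hftiladd : ∀ m n, ftil (m + n) = ftil m * ftil n)
    (f : ℂ → ℂ) (hf0 : ∀ x, f x ≠ 0) (hfadd : ∀ x y, f (x + y) = f x * f y)
    (hext : ∀ m : ↥Γ, f (m : ℂ) = ftil m) :
    ∃ e : weightedSpace ≃ₗ[ℂ] (ℂ →₀ ℂ),
      ∀ (m : ↥Γ) (w : weightedSpace),
        e (weightedAct Γ ftil α m w) = interAct (1 - α) (m : ℂ) (e w) := by
  refine ⟨weightEquiv f hf0, fun m w => ?_⟩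
  induction w using DirectSum.induction_on with
  | zero => simp [interAct]
  | add x y hx hy => rw [map_add, map_add, map_add, hx, hy, interAct_add]
  | of z q =>
    obtain ⟨P, rfl⟩ := Submodule.Quotient.mk_surjective _ q
    rw [← DirectSum.lof_eq_of ℂ, weightEquiv_lof, weightedAct, DirectSum.toModule_lof,
      LinearMap.comp_apply, Submodule.mapQ_apply, weightEquiv_lof, interAct,
      Finsupp.sum_single_index (by simp), Finsupp.smul_single]
    congr 1
    have hz : f z = f (z - m) * ftil m := by rw [← hext, ← hfadd, sub_add_cancel]
    simp [omegaActL, ← comp_eq_aeval, hz]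
    ring
end

section
/- Let α ∈ ℂ. The W_ℂ-module V_ℂ(α) (intermediate series module over the ℂ-Witt algebra) is simple if and only if α ≠ 0 and α ≠ 1. Moreover, V_ℂ(0) has a unique nonzero proper submodule, namely ℂv_0, and V_ℂ(1) has a unique nonzero proper submodule, namely ⊕_{z ∈ ℂ*} ℂv_z. -/
open Finsupp

lemma interAct_apply (a m : ℂ) (x : ℂ →₀ ℂ) (j : ℂ) :
    interAct a m x j = x (j + m) * (j + m - a * m) := by
  classical
  unfold interAct
  rw [Finsupp.sum, Finsupp.finsetSum_apply]
  rw [Finset.sum_eq_single (j + m)]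
  · simp
  · intro b _ hb
    have : b - m ≠ j := fun h => hb (by rw [← h]; ring)
    simp [Finsupp.single_apply, this]
  · intro h
    have : x (j + m) = 0 := by simpa using h
    simp [this]

lemma weight_mem (a : ℂ) (N : Submodule ℂ (ℂ →₀ ℂ))
    (hN : ∀ (m : ℂ) (x : ℂ →₀ ℂ), x ∈ N → interAct a m x ∈ N) (k : ℂ) :
    ∀ (n : ℕ) (x : ℂ →₀ ℂ), x.support.card ≤ n → x ∈ N → x k ≠ 0 →
      Finsupp.single k (1 : ℂ) ∈ N := by
  classical
  intro n
  induction n with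
  | zero =>
    intro x hx _ hk
    have : x = 0 := by simpa using hx
    simp [this] at hk
  | succ n ih =>
    intro x hx hxN hk
    by_cases h : ∃ k0, k0 ≠ k ∧ x k0 ≠ 0
    · obtain ⟨k0, h0, hx0⟩ := h
      have happ : ∀ j, (interAct a 0 x - k0 • x) j = (j - k0) * x j := by
        intro j
        simp [interAct_apply]
        ring
      refine ih (interAct a 0 x - k0 • x) ?_ (N.sub_mem (hN 0 x hxN) (N.smul_mem _ hxN)) ?_
      · have hsub : (interAct a 0 x - k0 • x).support ⊆ x.support.erase k0 := by
          intro j hj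
          rw [Finsupp.mem_support_iff, happ] at hj
          rw [Finset.mem_erase, Finsupp.mem_support_iff]
          exact ⟨sub_ne_zero.mp (left_ne_zero_of_mul hj), right_ne_zero_of_mul hj⟩
        have h1 := Finset.card_le_card hsub
        rw [Finset.card_erase_of_mem (by simpa using hx0)] at h1
        omega
      · rw [happ]
        exact mul_ne_zero (sub_ne_zero.mpr h0.symm) hk
    · push Not at h
      have : Finsupp.single k (1 : ℂ) = (x k)⁻¹ • x := by
        ext j
        by_cases hj : j = k
        · subst hj
          simp [hk]
        · simp [h j hj, Finsupp.single_apply, Ne.symm hj]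
      rw [this]
      exact N.smul_mem _ hxN

lemma weight_mem' {a : ℂ} {N : Submodule ℂ (ℂ →₀ ℂ)}
    (hN : ∀ (m : ℂ) (x : ℂ →₀ ℂ), x ∈ N → interAct a m x ∈ N) {x : ℂ →₀ ℂ} (hx : x ∈ N)
    {k : ℂ} (hk : x k ≠ 0) : Finsupp.single k (1 : ℂ) ∈ N :=
  weight_mem a N hN k _ x le_rfl hx hk

lemma step_mem {a : ℂ} {N : Submodule ℂ (ℂ →₀ ℂ)}
    (hN : ∀ (m : ℂ) (x : ℂ →₀ ℂ), x ∈ N → interAct a m x ∈ N) {k : ℂ}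
    (hk : Finsupp.single k (1 : ℂ) ∈ N) (j : ℂ) (h : (1 - a) * k + a * j ≠ 0) :
    Finsupp.single j (1 : ℂ) ∈ N := by
  refine weight_mem' hN (hN (k - j) _ hk) ?_
  rw [interAct_apply]
  have : j + (k - j) = k := by ring
  rw [this]
  simp only [Finsupp.single_eq_same, one_mul]
  intro h'
  exact h (by rw [← h']; ring)

lemma mem_of_single {N : Submodule ℂ (ℂ →₀ ℂ)} {x : ℂ →₀ ℂ}
    (h : ∀ j, x j ≠ 0 → Finsupp.single j (1 : ℂ) ∈ N) : x ∈ N := by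
  rw [← Finsupp.sum_single x]
  refine N.sum_mem fun j hj => ?_
  have := N.smul_mem (x j) (h j (by simpa using hj))
  simpa using this

lemma exists_single {a : ℂ} {N : Submodule ℂ (ℂ →₀ ℂ)}
    (hN : ∀ (m : ℂ) (x : ℂ →₀ ℂ), x ∈ N → interAct a m x ∈ N) (hb : N ≠ ⊥) :
    ∃ k, Finsupp.single k (1 : ℂ) ∈ N := by
  obtain ⟨x, hx, h0⟩ := N.ne_bot_iff.mp hb
  obtain ⟨k, hk⟩ := Finsupp.ne_iff.mp h0
  exact ⟨k, weight_mem' hN hx (by simpa using hk)⟩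

lemma mem_span_zero (x : ℂ →₀ ℂ) :
    x ∈ Submodule.span ℂ {Finsupp.single (0 : ℂ) (1 : ℂ)} ↔ ∀ j, j ≠ 0 → x j = 0 := by
  constructor
  · intro hx j hj
    obtain ⟨c, rfl⟩ := Submodule.mem_span_singleton.mp hx
    simp [Finsupp.single_apply, Ne.symm hj]
  · intro h
    refine mem_of_single fun j hj => ?_
    have : j = 0 := by
      by_contra h'
      exact hj (h j h')
    subst this
    exact Submodule.subset_span rfl

lemma mem_supp_ne (x : ℂ →₀ ℂ) :
    x ∈ Finsupp.supported ℂ ℂ {z : ℂ | z ≠ 0} ↔ x 0 = 0 := by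
  rw [Finsupp.mem_supported']
  simp

lemma part_zero : ((∀ (m : ℂ) (x : ℂ →₀ ℂ), x ∈ Submodule.span ℂ {Finsupp.single (0 : ℂ) (1 : ℂ)} →
        interAct 0 m x ∈ Submodule.span ℂ {Finsupp.single (0 : ℂ) (1 : ℂ)}) ∧
      Submodule.span ℂ {Finsupp.single (0 : ℂ) (1 : ℂ)} ≠ (⊥ : Submodule ℂ (ℂ →₀ ℂ)) ∧
      Submodule.span ℂ {Finsupp.single (0 : ℂ) (1 : ℂ)} ≠ (⊤ : Submodule ℂ (ℂ →₀ ℂ)) ∧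
      ∀ N : Submodule ℂ (ℂ →₀ ℂ),
        (∀ (m : ℂ) (x : ℂ →₀ ℂ), x ∈ N → interAct 0 m x ∈ N) → N ≠ ⊥ → N ≠ ⊤ →
        N = Submodule.span ℂ {Finsupp.single (0 : ℂ) (1 : ℂ)}) := by
  refine ⟨?_, ?_, ?_, ?_⟩
  · intro m x hx
    rw [mem_span_zero] at hx ⊢
    intro j _
    rw [interAct_apply]
    by_cases h : j + m = 0
    · simp [h]
    · simp [hx _ h]
  · simp
  · intro h
    have h1 : Finsupp.single (1 : ℂ) (1 : ℂ) ∈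
        Submodule.span ℂ {Finsupp.single (0 : ℂ) (1 : ℂ)} := by rw [h]; trivial
    rw [mem_span_zero] at h1
    have := h1 1 one_ne_zero
    simp at this
  · intro N hN hb ht
    have key : ∀ k, Finsupp.single k (1 : ℂ) ∈ N → k = 0 := by
      intro k hk
      by_contra h0
      refine ht (eq_top_iff.mpr fun x _ => mem_of_single fun j _ => step_mem hN hk j ?_)
      simpa using h0
    obtain ⟨k, hk⟩ := exists_single hN hb
    have h0 := key k hk
    subst h0
    apply le_antisymm
    · intro x hx
      rw [mem_span_zero]
      intro j hj
      by_contra h'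
      exact hj (key j (weight_mem' hN hx h'))
    · rw [Submodule.span_le]
      simpa using hk

lemma part_one_s18 : ((∀ (m : ℂ) (x : ℂ →₀ ℂ), x ∈ Finsupp.supported ℂ ℂ {z : ℂ | z ≠ 0} →
        interAct 1 m x ∈ Finsupp.supported ℂ ℂ {z : ℂ | z ≠ 0}) ∧
      Finsupp.supported ℂ ℂ {z : ℂ | z ≠ 0} ≠ (⊥ : Submodule ℂ (ℂ →₀ ℂ)) ∧
      Finsupp.supported ℂ ℂ {z : ℂ | z ≠ 0} ≠ (⊤ : Submodule ℂ (ℂ →₀ ℂ)) ∧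
      ∀ N : Submodule ℂ (ℂ →₀ ℂ),
        (∀ (m : ℂ) (x : ℂ →₀ ℂ), x ∈ N → interAct 1 m x ∈ N) → N ≠ ⊥ → N ≠ ⊤ →
        N = Finsupp.supported ℂ ℂ {z : ℂ | z ≠ 0}) := by
  refine ⟨?_, ?_, ?_, ?_⟩
  · intro m x hx
    rw [mem_supp_ne] at hx ⊢
    rw [interAct_apply]
    simp
  · rw [Submodule.ne_bot_iff]
    exact ⟨Finsupp.single 1 1, by rw [mem_supp_ne]; simp, by simp⟩
  · intro h
    have h1 : Finsupp.single (0 : ℂ) (1 : ℂ) ∈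
        Finsupp.supported ℂ ℂ {z : ℂ | z ≠ 0} := by rw [h]; trivial
    rw [mem_supp_ne] at h1
    simp at h1
  · intro N hN hb ht
    obtain ⟨k, hk⟩ := exists_single hN hb
    have hall : ∀ j, j ≠ 0 → Finsupp.single j (1 : ℂ) ∈ N := fun j hj =>
      step_mem hN hk j (by simpa using hj)
    apply le_antisymm
    · intro x hx
      rw [mem_supp_ne]
      by_contra h'
      refine ht (eq_top_iff.mpr fun y _ => mem_of_single fun j _ => ?_)
      by_cases hj : j = 0
      · subst hj
        exact weight_mem' hN hx h'
      · exact hall j hj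
    · intro x hx
      rw [mem_supp_ne] at hx
      refine mem_of_single fun j hj => hall j ?_
      rintro rfl
      exact hj hx

lemma part_simple {a : ℂ} (h0 : a ≠ 0) (h1 : a ≠ 1) (N : Submodule ℂ (ℂ →₀ ℂ))
    (hN : ∀ (m : ℂ) (x : ℂ →₀ ℂ), x ∈ N → interAct a m x ∈ N) : N = ⊥ ∨ N = ⊤ := by
  classical
  by_cases hb : N = ⊥
  · exact Or.inl hb
  right
  obtain ⟨k, hk⟩ := exists_single hN hb
  refine eq_top_iff.mpr fun y _ => mem_of_single fun j _ => ?_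
  have h1' : 1 - a ≠ 0 := sub_ne_zero.mpr h1.symm
  obtain ⟨i, hi⟩ := Infinite.exists_notMem_finset
    ({-((1 - a) * k) / a, -(a * j) / (1 - a)} : Finset ℂ)
  simp only [Finset.mem_insert, Finset.mem_singleton, not_or] at hi
  have hiN : Finsupp.single i (1 : ℂ) ∈ N := by
    refine step_mem hN hk i fun h => hi.1 ?_
    rw [eq_div_iff h0]
    linear_combination h
  refine step_mem hN hiN j fun h => hi.2 ?_
  rw [eq_div_iff h1']
  linear_combination h

/-- The `W_ℂ`-module `V_ℂ(α)` is simple iff `α ≠ 0` and `α ≠ 1`; moreover `V_ℂ(0)` has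
`ℂ v₀` as unique nonzero proper submodule, and `V_ℂ(1)` has `⊕_{z ≠ 0} ℂ v_z` as unique
nonzero proper submodule. -/
theorem stmt18 (α : ℂ) :
    ((∀ N : Submodule ℂ (ℂ →₀ ℂ),
        (∀ (m : ℂ) (x : ℂ →₀ ℂ), x ∈ N → interAct α m x ∈ N) → N = ⊥ ∨ N = ⊤) ↔
      (α ≠ 0 ∧ α ≠ 1)) ∧
    -- `V_ℂ(0)`: unique nonzero proper submodule `ℂ v₀`
    ((∀ (m : ℂ) (x : ℂ →₀ ℂ), x ∈ Submodule.span ℂ {Finsupp.single (0 : ℂ) (1 : ℂ)} →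
        interAct 0 m x ∈ Submodule.span ℂ {Finsupp.single (0 : ℂ) (1 : ℂ)}) ∧
      Submodule.span ℂ {Finsupp.single (0 : ℂ) (1 : ℂ)} ≠ (⊥ : Submodule ℂ (ℂ →₀ ℂ)) ∧
      Submodule.span ℂ {Finsupp.single (0 : ℂ) (1 : ℂ)} ≠ (⊤ : Submodule ℂ (ℂ →₀ ℂ)) ∧
      ∀ N : Submodule ℂ (ℂ →₀ ℂ),
        (∀ (m : ℂ) (x : ℂ →₀ ℂ), x ∈ N → interAct 0 m x ∈ N) → N ≠ ⊥ → N ≠ ⊤ →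
        N = Submodule.span ℂ {Finsupp.single (0 : ℂ) (1 : ℂ)}) ∧
    -- `V_ℂ(1)`: unique nonzero proper submodule `⊕_{z ≠ 0} ℂ v_z`
    ((∀ (m : ℂ) (x : ℂ →₀ ℂ), x ∈ Finsupp.supported ℂ ℂ {z : ℂ | z ≠ 0} →
        interAct 1 m x ∈ Finsupp.supported ℂ ℂ {z : ℂ | z ≠ 0}) ∧
      Finsupp.supported ℂ ℂ {z : ℂ | z ≠ 0} ≠ (⊥ : Submodule ℂ (ℂ →₀ ℂ)) ∧
      Finsupp.supported ℂ ℂ {z : ℂ | z ≠ 0} ≠ (⊤ : Submodule ℂ (ℂ →₀ ℂ)) ∧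
      ∀ N : Submodule ℂ (ℂ →₀ ℂ),
        (∀ (m : ℂ) (x : ℂ →₀ ℂ), x ∈ N → interAct 1 m x ∈ N) → N ≠ ⊥ → N ≠ ⊤ →
        N = Finsupp.supported ℂ ℂ {z : ℂ | z ≠ 0}) := by
  refine ⟨⟨fun h => ⟨?_, ?_⟩, fun h N hN => part_simple h.1 h.2 N hN⟩, part_zero, part_one_s18⟩
  · rintro rfl
    rcases h _ part_zero.1 with h' | h'
    · exact part_zero.2.1 h'
    · exact part_zero.2.2.1 h'
  · rintro rfl
    rcases h _ part_one_s18.1 with h' | h'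
    · exact part_one_s18.2.1 h'
    · exact part_one_s18.2.2.1 h'
end

section
/- Let α ∈ ℂ. The sW_ℂ-module sV_ℂ(α) (super intermediate series module over the ℂ-Witt superalgebra with Γ_0 = Γ_1 = ℂ) is simple if and only if α ≠ 1/2 and α ≠ 1. Moreover, sV_ℂ(1/2) has a unique nonzero proper submodule, namely ℂw_0, and sV_ℂ(1) has a unique nonzero proper submodule, namely the submodule with even part ⊕_{k ∈ ℂ*} ℂv_k and odd part all of sV_ℂ(1)_1̄. -/
open Finsupp

/-- The action of `L_m` (`m ∈ ℂ`) of the `ℂ`-Witt superalgebra on the super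
intermediate series module `sV_ℂ(a)` with even basis `{v_k}` and odd basis `{w_j}`
(a pair `(x, y)` records the `v`- and the `w`-coordinates):
`L_m v_k = (k - am) v_{k-m}`, `L_m w_j = (j - (a - 1/2)m) w_{j-m}`. -/
noncomputable def sInterActL (a m : ℂ) (v : (ℂ →₀ ℂ) × (ℂ →₀ ℂ)) :
    (ℂ →₀ ℂ) × (ℂ →₀ ℂ) :=
  (v.1.sum fun k c => (c * (k - a * m)) • Finsupp.single (k - m) (1 : ℂ),
   v.2.sum fun j c => (c * (j - (a - 1 / 2) * m)) • Finsupp.single (j - m) (1 : ℂ))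

/-- The action of `G_r` (`r ∈ ℂ`) of the `ℂ`-Witt superalgebra on `sV_ℂ(a)`:
`G_r v_k = w_{k-r}`, `G_r w_j = (j - 2r(a - 1/2)) v_{j-r}`. -/
noncomputable def sInterActG (a r : ℂ) (v : (ℂ →₀ ℂ) × (ℂ →₀ ℂ)) :
    (ℂ →₀ ℂ) × (ℂ →₀ ℂ) :=
  (v.2.sum fun j c => (c * (j - 2 * r * (a - 1 / 2))) • Finsupp.single (j - r) (1 : ℂ),
   v.1.sum fun k c => c • Finsupp.single (k - r) (1 : ℂ))


namespace SV

abbrev V := (ℂ →₀ ℂ) × (ℂ →₀ ℂ)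

/-- Closed graded submodules. -/
structure Cl (a : ℂ) (N : Submodule ℂ V) : Prop where
  gr : ∀ v ∈ N, ((v.1, 0) : V) ∈ N ∧ ((0, v.2) : V) ∈ N
  hL : ∀ (m : ℂ) v, v ∈ N → sInterActL a m v ∈ N
  hG : ∀ (r : ℂ) v, v ∈ N → sInterActG a r v ∈ N

/-- A subspace stable under the diagonal operator contains the components of its elements. -/
lemma comp_mem (M : Submodule ℂ (ℂ →₀ ℂ))
    (h : ∀ f ∈ M, (f.sum fun k c => (c * k) • Finsupp.single k (1 : ℂ)) ∈ M)
    (f : ℂ →₀ ℂ) (hf : f ∈ M) (k : ℂ) (hk : k ∈ f.support) :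
    Finsupp.single k (1 : ℂ) ∈ M := by
  classical
  have hd : ∀ (g : ℂ →₀ ℂ) (i : ℂ),
      (g.sum fun k c => (c * k) • Finsupp.single k (1 : ℂ)) i = g i * i := by
    intro g i
    rw [Finsupp.sum_apply, Finsupp.sum, Finset.sum_eq_single i]
    · simp
    · intro b _ hb
      simp [hb]
    · intro hi
      simp [Finsupp.notMem_support_iff.mp hi]
  have key : ∀ s : Finset ℂ, ∃ g ∈ M, ∀ i, g i = (∏ j ∈ s, (i - j)) * f i := by
    intro s
    induction s using Finset.induction_on with
    | empty => exact ⟨f, hf, by simp⟩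
    | insert j s hj ih =>
      obtain ⟨g, hg, hgi⟩ := ih
      refine ⟨_, M.sub_mem (h g hg) (M.smul_mem j hg), fun i => ?_⟩
      rw [Finsupp.sub_apply, hd, Finset.prod_insert hj, Finsupp.smul_apply, hgi, smul_eq_mul]
      ring
  obtain ⟨g, hg, hgi⟩ := key (f.support.erase k)
  have hne : (∏ j ∈ f.support.erase k, (k - j)) * f k ≠ 0 := by
    refine mul_ne_zero (Finset.prod_ne_zero_iff.mpr fun j hj => ?_)
      (Finsupp.mem_support_iff.mp hk)
    exact sub_ne_zero.mpr (Finset.ne_of_mem_erase hj).symm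
  have : Finsupp.single k (1 : ℂ) = ((∏ j ∈ f.support.erase k, (k - j)) * f k)⁻¹ • g := by
    ext i
    rw [Finsupp.smul_apply, hgi, smul_eq_mul]
    by_cases hik : k = i
    · subst hik
      rw [inv_mul_cancel₀ hne]; simp
    · rw [Finsupp.single_eq_of_ne (Ne.symm hik)]
      by_cases hi : i ∈ f.support
      · rw [Finset.prod_eq_zero (i := i) (Finset.mem_erase.mpr ⟨Ne.symm hik, hi⟩) (sub_self i)]
        simp
      · simp [Finsupp.notMem_support_iff.mp hi]
  rw [this]
  exact M.smul_mem _ hg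

lemma mem_of_comp (M : Submodule ℂ (ℂ →₀ ℂ)) (f : ℂ →₀ ℂ)
    (h : ∀ k ∈ f.support, Finsupp.single k (1 : ℂ) ∈ M) : f ∈ M := by
  rw [← Finsupp.sum_single f]
  refine M.sum_mem fun k hk => ?_
  have := M.smul_mem (f k) (h k hk)
  simpa using this

variable {a : ℂ} {N : Submodule ℂ V}

lemma Cl.compE (h : Cl a N) {v : V} (hv : v ∈ N) {k : ℂ} (hk : k ∈ v.1.support) :
    ((Finsupp.single k (1 : ℂ), 0) : V) ∈ N := by
  refine comp_mem (N.comap (LinearMap.inl ℂ (ℂ →₀ ℂ) (ℂ →₀ ℂ))) ?_ v.1 (h.gr v hv).1 k hk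
  intro f hf
  have := h.hL 0 _ hf
  simpa [sInterActL] using this

lemma Cl.compO (h : Cl a N) {v : V} (hv : v ∈ N) {k : ℂ} (hk : k ∈ v.2.support) :
    ((0, Finsupp.single k (1 : ℂ)) : V) ∈ N := by
  refine comp_mem (N.comap (LinearMap.inr ℂ (ℂ →₀ ℂ) (ℂ →₀ ℂ))) ?_ v.2 (h.gr v hv).2 k hk
  intro f hf
  have := h.hL 0 _ hf
  simpa [sInterActL] using this

lemma mem_of (v : V) (h1 : ∀ k ∈ v.1.support, ((Finsupp.single k (1 : ℂ), 0) : V) ∈ N)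
    (h2 : ∀ k ∈ v.2.support, ((0, Finsupp.single k (1 : ℂ)) : V) ∈ N) : v ∈ N := by
  have e1 := mem_of_comp (N.comap (LinearMap.inl ℂ (ℂ →₀ ℂ) (ℂ →₀ ℂ))) v.1 h1
  have e2 := mem_of_comp (N.comap (LinearMap.inr ℂ (ℂ →₀ ℂ) (ℂ →₀ ℂ))) v.2 h2
  have := N.add_mem e1 e2
  simpa using this

lemma Cl.EO (h : Cl a N) {k : ℂ} (hk : ((Finsupp.single k (1 : ℂ), 0) : V) ∈ N) (j : ℂ) :
    ((0, Finsupp.single j (1 : ℂ)) : V) ∈ N := by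
  have := h.hG (k - j) _ hk
  simpa [sInterActG] using this

lemma Cl.OE (h : Cl a N) {j : ℂ} (hj : ((0, Finsupp.single j (1 : ℂ)) : V) ∈ N) (r : ℂ)
    (hr : j - 2 * r * (a - 1 / 2) ≠ 0) : ((Finsupp.single (j - r) (1 : ℂ), 0) : V) ∈ N := by
  have := N.smul_mem (j - 2 * r * (a - 1 / 2))⁻¹ (h.hG r _ hj)
  have e : (j - 2 * r * (a - 1 / 2))⁻¹ • sInterActG a r (0, Finsupp.single j (1 : ℂ))
      = ((Finsupp.single (j - r) (1 : ℂ), 0) : V) := by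
    unfold sInterActG
    rw [Finsupp.sum_single_index (by simp), Finsupp.sum_zero_index, one_mul, Prod.smul_mk,
      inv_smul_smul₀ hr, smul_zero]
  rwa [e] at this

noncomputable abbrev A : Submodule ℂ V :=
  (⊥ : Submodule ℂ (ℂ →₀ ℂ)).prod (Submodule.span ℂ {Finsupp.single (0 : ℂ) (1 : ℂ)})

noncomputable abbrev B : Submodule ℂ V :=
  (Finsupp.supported ℂ ℂ {z : ℂ | z ≠ 0}).prod (⊤ : Submodule ℂ (ℂ →₀ ℂ))

lemma classify (h : Cl a N) : N = ⊥ ∨ N = ⊤ ∨ (a = 1 / 2 ∧ N = A) ∨ (a = 1 ∧ N = B) := by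
  by_cases hE : ∃ k, ((Finsupp.single k (1 : ℂ), 0) : V) ∈ N
  · obtain ⟨k, hk⟩ := hE
    have hO := h.EO hk
    have hE' : ∀ i r : ℂ, i + r * (2 - 2 * a) ≠ 0 →
        ((Finsupp.single i (1 : ℂ), 0) : V) ∈ N := by
      intro i r hir
      have := h.OE (hO (i + r)) r (by convert hir using 1; ring)
      simpa using this
    have hne : ∀ i : ℂ, i ≠ 0 → ((Finsupp.single i (1 : ℂ), 0) : V) ∈ N :=
      fun i hi => hE' i 0 (by simpa using hi)
    by_cases h0 : ((Finsupp.single 0 (1 : ℂ), 0) : V) ∈ N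
    · right; left
      rw [eq_top_iff]
      intro v _
      refine mem_of v (fun i _ => ?_) (fun i _ => hO i)
      by_cases hi : i = 0
      · rwa [hi]
      · exact hne i hi
    · right; right; right
      constructor
      · by_contra ha
        refine h0 (hE' 0 1 ?_)
        intro e
        apply ha
        linear_combination (-1 / 2) * e
      · ext v
        constructor
        · intro hv
          refine ⟨?_, trivial⟩
          rw [SetLike.mem_coe, Finsupp.mem_supported]
          intro i hi hi0
          exact h0 (hi0 ▸ h.compE hv hi)
        · rintro ⟨hv, -⟩
          rw [SetLike.mem_coe, Finsupp.mem_supported] at hv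
          exact mem_of v (fun i hi => hne i (hv hi)) (fun i _ => hO i)
  · push Not at hE
    have hv1 : ∀ v ∈ N, v.1 = 0 := by
      intro v hv
      by_contra hc
      obtain ⟨k, hk⟩ := Finsupp.support_nonempty_iff.mpr hc
      exact hE k (h.compE hv hk)
    by_cases hO : ∃ j, ((0, Finsupp.single j (1 : ℂ)) : V) ∈ N
    · have hz : ∀ j, ((0, Finsupp.single j (1 : ℂ)) : V) ∈ N → j = 0 ∧ a = 1 / 2 := by
        intro j hj
        have hr : ∀ r : ℂ, j - 2 * r * (a - 1 / 2) = 0 := by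
          intro r
          by_contra hc
          exact hE _ (h.OE hj r hc)
        have e0 := hr 0
        have e1 := hr 1
        constructor
        · linear_combination e0
        · linear_combination (1 / 2) * e0 - (1 / 2) * e1
      obtain ⟨j, hj⟩ := hO
      obtain ⟨rfl, ha⟩ := hz j hj
      right; right; left
      refine ⟨ha, ?_⟩
      ext v
      constructor
      · intro hv
        refine ⟨hv1 v hv, ?_⟩
        refine mem_of_comp _ _ fun k hk => ?_
        rw [(hz k (h.compO hv hk)).1]
        exact Submodule.mem_span_singleton_self _
      · rintro ⟨h1, h2⟩
        obtain ⟨c, hc⟩ := Submodule.mem_span_singleton.mp h2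
        have h1' : v.1 = 0 := h1
        have := N.smul_mem c hj
        rw [Prod.smul_mk, hc, smul_zero, ← h1'] at this
        exact this
    · left
      push Not at hO
      rw [eq_bot_iff]
      intro v hv
      have h2 : v.2 = 0 := by
        by_contra hc
        obtain ⟨k, hk⟩ := Finsupp.support_nonempty_iff.mpr hc
        exact hO k (h.compO hv hk)
      exact Prod.ext (hv1 v hv) h2

lemma clA : Cl (1 / 2) A := by
  have form : ∀ v ∈ A, ∃ c : ℂ, v = (0, Finsupp.single 0 c) := by
    rintro ⟨x, y⟩ ⟨h1, h2⟩
    obtain ⟨c, hc⟩ := Submodule.mem_span_singleton.mp h2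
    refine ⟨c, Prod.ext h1 ?_⟩
    simp only at hc ⊢
    rw [← hc]; simp
  refine ⟨?_, ?_, ?_⟩
  · rintro v ⟨h1, h2⟩
    exact ⟨⟨h1, Submodule.zero_mem _⟩, ⟨Submodule.zero_mem _, h2⟩⟩
  · intro m v hv
    obtain ⟨c, rfl⟩ := form v hv
    have : sInterActL (1 / 2) m (0, Finsupp.single 0 c) = 0 := by simp [sInterActL]
    rw [this]; exact Submodule.zero_mem _
  · intro m v hv
    obtain ⟨c, rfl⟩ := form v hv
    have : sInterActG (1 / 2) m (0, Finsupp.single 0 c) = 0 := by simp [sInterActG]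
    rw [this]; exact Submodule.zero_mem _

lemma clB : Cl 1 B := by
  have hs : ∀ (c k : ℂ), k ≠ 0 ∨ c = 0 → c • Finsupp.single k (1 : ℂ) ∈
      Finsupp.supported ℂ ℂ {z : ℂ | z ≠ 0} := by
    rintro c k (hk | rfl)
    · exact Submodule.smul_mem _ _ (Finsupp.single_mem_supported ℂ _ hk)
    · simp
  refine ⟨?_, ?_, ?_⟩
  · rintro v ⟨h1, h2⟩
    exact ⟨⟨h1, trivial⟩, ⟨Submodule.zero_mem _, trivial⟩⟩
  · rintro m v -
    refine ⟨Submodule.sum_mem _ fun k _ => hs _ _ ?_, trivial⟩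
    by_cases hk : k - m = 0
    · right; rw [one_mul, hk, mul_zero]
    · exact Or.inl hk
  · rintro m v -
    refine ⟨Submodule.sum_mem _ fun k _ => hs _ _ ?_, trivial⟩
    by_cases hk : k - m = 0
    · right; linear_combination (v.2 k) * hk
    · exact Or.inl hk

lemma A_ne_bot : A ≠ ⊥ := by
  intro h
  have : ((0, Finsupp.single 0 1) : V) ∈ A :=
    ⟨Submodule.zero_mem _, Submodule.mem_span_singleton_self _⟩
  rw [h, Submodule.mem_bot] at this
  simp at this

lemma A_ne_top : A ≠ ⊤ := by
  intro h
  have : ((Finsupp.single 0 1, 0) : V) ∈ A := h ▸ trivial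
  have h1 : (Finsupp.single 0 1 : ℂ →₀ ℂ) = 0 := this.1
  simp at h1

lemma B_ne_bot : B ≠ ⊥ := by
  intro h
  have : ((0, Finsupp.single 0 1) : V) ∈ B := ⟨Submodule.zero_mem _, trivial⟩
  rw [h, Submodule.mem_bot] at this
  simp at this

lemma B_ne_top : B ≠ ⊤ := by
  intro h
  have : ((Finsupp.single 0 1, 0) : V) ∈ B := h ▸ trivial
  have h1 := (Finsupp.mem_supported ℂ _).mp this.1
  have h2 : (0 : ℂ) ∈ {z : ℂ | z ≠ 0} := h1 (by simp)
  exact h2 rfl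

end SV

/-- The `sW_ℂ`-module `sV_ℂ(α)` is simple (no nonzero proper graded submodules) iff
`α ≠ 1/2` and `α ≠ 1`; moreover `sV_ℂ(1/2)` has `ℂ w₀` as unique nonzero proper
submodule, and `sV_ℂ(1)` has the submodule with even part `⊕_{k ≠ 0} ℂ v_k` and odd
part everything as unique nonzero proper submodule. -/
theorem stmt19 (α : ℂ) :
    ((∀ N : Submodule ℂ ((ℂ →₀ ℂ) × (ℂ →₀ ℂ)),
        (∀ v ∈ N, ((v.1, 0) : (ℂ →₀ ℂ) × (ℂ →₀ ℂ)) ∈ N ∧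
          ((0, v.2) : (ℂ →₀ ℂ) × (ℂ →₀ ℂ)) ∈ N) →
        (∀ (m : ℂ) v, v ∈ N → sInterActL α m v ∈ N) →
        (∀ (r : ℂ) v, v ∈ N → sInterActG α r v ∈ N) →
        N = ⊥ ∨ N = ⊤) ↔ (α ≠ 1 / 2 ∧ α ≠ 1)) ∧
    -- `sV_ℂ(1/2)`: unique nonzero proper submodule `ℂ w₀`
    ((∀ (m : ℂ) v, v ∈ (⊥ : Submodule ℂ (ℂ →₀ ℂ)).prod
          (Submodule.span ℂ {Finsupp.single (0 : ℂ) (1 : ℂ)}) →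
        sInterActL (1 / 2) m v ∈ (⊥ : Submodule ℂ (ℂ →₀ ℂ)).prod
          (Submodule.span ℂ {Finsupp.single (0 : ℂ) (1 : ℂ)})) ∧
      (∀ (r : ℂ) v, v ∈ (⊥ : Submodule ℂ (ℂ →₀ ℂ)).prod
          (Submodule.span ℂ {Finsupp.single (0 : ℂ) (1 : ℂ)}) →
        sInterActG (1 / 2) r v ∈ (⊥ : Submodule ℂ (ℂ →₀ ℂ)).prod
          (Submodule.span ℂ {Finsupp.single (0 : ℂ) (1 : ℂ)})) ∧
      (⊥ : Submodule ℂ (ℂ →₀ ℂ)).prod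
          (Submodule.span ℂ {Finsupp.single (0 : ℂ) (1 : ℂ)}) ≠ ⊥ ∧
      (⊥ : Submodule ℂ (ℂ →₀ ℂ)).prod
          (Submodule.span ℂ {Finsupp.single (0 : ℂ) (1 : ℂ)}) ≠ ⊤ ∧
      ∀ N : Submodule ℂ ((ℂ →₀ ℂ) × (ℂ →₀ ℂ)),
        (∀ v ∈ N, ((v.1, 0) : (ℂ →₀ ℂ) × (ℂ →₀ ℂ)) ∈ N ∧
          ((0, v.2) : (ℂ →₀ ℂ) × (ℂ →₀ ℂ)) ∈ N) →
        (∀ (m : ℂ) v, v ∈ N → sInterActL (1 / 2) m v ∈ N) →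
        (∀ (r : ℂ) v, v ∈ N → sInterActG (1 / 2) r v ∈ N) →
        N ≠ ⊥ → N ≠ ⊤ →
        N = (⊥ : Submodule ℂ (ℂ →₀ ℂ)).prod
          (Submodule.span ℂ {Finsupp.single (0 : ℂ) (1 : ℂ)})) ∧
    -- `sV_ℂ(1)`: unique nonzero proper submodule `(⊕_{k ≠ 0} ℂ v_k) ⊕ sV_ℂ(1)₁`
    ((∀ (m : ℂ) v, v ∈ (Finsupp.supported ℂ ℂ {z : ℂ | z ≠ 0}).prod
          (⊤ : Submodule ℂ (ℂ →₀ ℂ)) →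
        sInterActL 1 m v ∈ (Finsupp.supported ℂ ℂ {z : ℂ | z ≠ 0}).prod
          (⊤ : Submodule ℂ (ℂ →₀ ℂ))) ∧
      (∀ (r : ℂ) v, v ∈ (Finsupp.supported ℂ ℂ {z : ℂ | z ≠ 0}).prod
          (⊤ : Submodule ℂ (ℂ →₀ ℂ)) →
        sInterActG 1 r v ∈ (Finsupp.supported ℂ ℂ {z : ℂ | z ≠ 0}).prod
          (⊤ : Submodule ℂ (ℂ →₀ ℂ))) ∧
      (Finsupp.supported ℂ ℂ {z : ℂ | z ≠ 0}).prod (⊤ : Submodule ℂ (ℂ →₀ ℂ)) ≠ ⊥ ∧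
      (Finsupp.supported ℂ ℂ {z : ℂ | z ≠ 0}).prod (⊤ : Submodule ℂ (ℂ →₀ ℂ)) ≠ ⊤ ∧
      ∀ N : Submodule ℂ ((ℂ →₀ ℂ) × (ℂ →₀ ℂ)),
        (∀ v ∈ N, ((v.1, 0) : (ℂ →₀ ℂ) × (ℂ →₀ ℂ)) ∈ N ∧
          ((0, v.2) : (ℂ →₀ ℂ) × (ℂ →₀ ℂ)) ∈ N) →
        (∀ (m : ℂ) v, v ∈ N → sInterActL 1 m v ∈ N) →
        (∀ (r : ℂ) v, v ∈ N → sInterActG 1 r v ∈ N) →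
        N ≠ ⊥ → N ≠ ⊤ →
        N = (Finsupp.supported ℂ ℂ {z : ℂ | z ≠ 0}).prod (⊤ : Submodule ℂ (ℂ →₀ ℂ))) := by
  refine ⟨⟨fun h => ⟨?_, ?_⟩, ?_⟩, ⟨SV.clA.hL, SV.clA.hG, SV.A_ne_bot, SV.A_ne_top, ?_⟩,
    ⟨SV.clB.hL, SV.clB.hG, SV.B_ne_bot, SV.B_ne_top, ?_⟩⟩
  · rintro rfl
    exact (h SV.A SV.clA.gr SV.clA.hL SV.clA.hG).elim SV.A_ne_bot SV.A_ne_top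
  · rintro rfl
    exact (h SV.B SV.clB.gr SV.clB.hL SV.clB.hG).elim SV.B_ne_bot SV.B_ne_top
  · rintro ⟨h1, h2⟩ N a b c
    rcases SV.classify ⟨a, b, c⟩ with h | h | h | h
    · exact Or.inl h
    · exact Or.inr h
    · exact absurd h.1 h1
    · exact absurd h.1 h2
  · intro N a b c n1 n2
    rcases SV.classify ⟨a, b, c⟩ with h | h | h | h
    · exact absurd h n1
    · exact absurd h n2
    · exact h.2
    · exact absurd h.1 (by norm_num)
  · intro N a b c n1 n2
    rcases SV.classify ⟨a, b, c⟩ with h | h | h | h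
    · exact absurd h n1
    · exact absurd h n2
    · exact absurd h.1 (by norm_num)
    · exact h.2
end
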